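/- arXiv:0810.5205 — 2 statements merged into one kernel-verified Lean document; each statement's English description precedes it below -/
import Mathlib

section
/- Let p be a prime and let α ∈ L_p not be the greatest element of L_p. Suppose there is an even index of α at which applying the applicable elementary operation (E_s or E_c) yields a lexical sequence; let i be the largest such even index and let α′ ∈ L_p be the result of applying that operation at cell i. Then α is adjacent to α′ in L_p. -/
/-!
Common definitions: α-sequences, the lexical order, elementary operations,
lexical sequences, harmonics, star products, etc.
-/

/-- The sign-alternating sequence `Al(τ)` associated to an α-sequence `τ`
(0-indexed: entry `i` of `Al τ` is `(-1)^i * τ_{i+1}`, and `0` beyond the length). -/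
def Al (τ : List ℕ) (i : ℕ) : ℤ := (-1 : ℤ) ^ i * (τ.getD i 0 : ℤ)

/-- The (strict) lexical order: `τ < τ'` iff the first nonzero entry of
`Al τ - Al τ'` is negative. -/
def lexLt (τ τ' : List ℕ) : Prop :=
  ∃ i, (∀ j < i, Al τ j = Al τ' j) ∧ Al τ i < Al τ' i

/-- An α-sequence: a nonempty finite sequence of positive integers. -/
def IsAlphaSeq (α : List ℕ) : Prop := α ≠ [] ∧ ∀ x ∈ α, 0 < x

/-- `Aset n` is the set `A_n` of α-sequences of degree `n`. -/
def Aset (n : ℕ) : Set (List ℕ) := {α | IsAlphaSeq α ∧ α.sum = n}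

/-- Splitting operation `E_s` at the (1-indexed) cell `i`:
`(α₁,…,α_{i-1}, α_i - 1, 1, α_{i+1},…,α_k)`. -/
def applyEs (α : List ℕ) (i : ℕ) : List ℕ :=
  α.take (i - 1) ++ [α.getD (i - 1) 0 - 1, 1] ++ α.drop i

/-- `E_s` is applicable at cell `i` iff `1 ≤ i ≤ l(α)` and `α_i > 1`. -/
def EsApplicable (α : List ℕ) (i : ℕ) : Prop :=
  1 ≤ i ∧ i ≤ α.length ∧ 1 < α.getD (i - 1) 0

/-- Conjugation operation `E_c` at the (1-indexed) cell `i`: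
`(α₁,…,α_{i-2}, α_{i-1} + 1, α_{i+1},…,α_k)`. -/
def applyEc (α : List ℕ) (i : ℕ) : List ℕ :=
  α.take (i - 2) ++ [α.getD (i - 2) 0 + 1] ++ α.drop i

/-- `E_c` is applicable at cell `i` iff `2 ≤ i ≤ l(α)` and `α_i = 1`. -/
def EcApplicable (α : List ℕ) (i : ℕ) : Prop :=
  2 ≤ i ∧ i ≤ α.length ∧ α.getD (i - 1) 0 = 1

/-- `α'` is obtained from `α` by applying one elementary operation (`E_s` or `E_c`)
at the (1-indexed) cell `i`. -/
def ElemOpAt (α : List ℕ) (i : ℕ) (α' : List ℕ) : Prop :=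
  (EsApplicable α i ∧ α' = applyEs α i) ∨ (EcApplicable α i ∧ α' = applyEc α i)

/-- `a < b` and `a`, `b` are adjacent in `S`: no element of `S` lies strictly between. -/
def AdjLtIn (S : Set (List ℕ)) (a b : List ℕ) : Prop :=
  lexLt a b ∧ ∀ γ ∈ S, ¬ (lexLt a γ ∧ lexLt γ b)

/-- An α-sequence is lexical iff it strictly exceeds all of its proper right sequences. -/
def IsLexical (α : List ℕ) : Prop :=
  IsAlphaSeq α ∧ ∀ i, 2 ≤ i → i ≤ α.length → lexLt (α.drop (i - 1)) α

/-- `Lset n` is the set `L_n` of lexical sequences `α` with `1 + D(α) = n`. -/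
def Lset (n : ℕ) : Set (List ℕ) := {α | IsLexical α ∧ 1 + α.sum = n}

/-- Add `1` to the last entry of a list. -/
def bumpLast (α : List ℕ) : List ℕ := α.dropLast ++ [α.getD (α.length - 1) 0 + 1]

/-- `α_e`: the even-length modification of `α`. -/
def seqE (α : List ℕ) : List ℕ := if Even α.length then bumpLast α else α ++ [1]

/-- `α_o`: the odd-length modification of `α`. -/
def seqO (α : List ℕ) : List ℕ := if Even α.length then α ++ [1] else bumpLast α

/-- The `j`-th harmonicSeq: `h_0(α) = α` and `h_j(α) = (h_{j-1}(α))_o h_{j-1}(α)`. -/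
def harmonicSeq : ℕ → List ℕ → List ℕ
  | 0, α => α
  | j + 1, α => seqO (harmonicSeq j α) ++ harmonicSeq j α

/-- A sequence is fundamental iff it is not a harmonicSeq `h_j(β)`, `j ≥ 1`,
of any α-sequence `β`. -/
def IsFundamental (α : List ℕ) : Prop :=
  ∀ β : List ℕ, IsAlphaSeq β → ∀ j, 1 ≤ j → α ≠ harmonicSeq j β

/-- `α^q`: the `q`-fold concatenation of `α` with itself. -/
def nrep (α : List ℕ) (q : ℕ) : List ℕ := (List.replicate q α).flatten

/-- The star product
`α ⋆ β = α_o (α_e)^{β₁-1} α_o (α_e)^{β₂-1} ⋯ α_o (α_e)^{β_k-1} α`. -/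
def starProd (α β : List ℕ) : List ℕ :=
  (β.map (fun b => seqO α ++ nrep (seqE α) (b - 1))).flatten ++ α

/-- `α ∧ β`: the longest common left factor, ended by the minimum of the
first differing entries. -/
def wedge : List ℕ → List ℕ → List ℕ
  | [], _ => []
  | _, [] => []
  | a :: as, b :: bs => if a = b then a :: wedge as bs else [min a b]

/-- `a` is the least element of `S` in the lexical order. -/
def LeastIn (S : Set (List ℕ)) (a : List ℕ) : Prop :=
  a ∈ S ∧ ∀ b ∈ S, b ≠ a → lexLt a b

/-- `a` is the greatest element of `S` in the lexical order. -/
def GreatestIn (S : Set (List ℕ)) (a : List ℕ) : Prop :=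
  a ∈ S ∧ ∀ b ∈ S, b ≠ a → lexLt b a

/-- `i` is an even (1-indexed) cell of `α` at which the applicable elementary
operation yields a lexical sequence. -/
def GoodEvenIndex (α : List ℕ) (i : ℕ) : Prop :=
  Even i ∧ ∃ α', ElemOpAt α i α' ∧ IsLexical α'

/-- `i` is an odd (1-indexed) cell of `α` at which the applicable elementary
operation yields a lexical sequence. -/
def GoodOddIndex (α : List ℕ) (i : ℕ) : Prop :=
  Odd i ∧ ∃ α', ElemOpAt α i α' ∧ IsLexical α'

/-- The successor operation: apply whichever of `E_s`, `E_c` is applicable at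
the largest even (1-indexed) index `≤ l(α)`, i.e. on the tail of the longest
left sequence of even length. -/
def succOp (α : List ℕ) : List ℕ :=
  let i := if Even α.length then α.length else α.length - 1
  if 1 < α.getD (i - 1) 0 then applyEs α i else applyEc α i

/-- The order on words: `x` and `y` agree before some index, at which `x` is smaller. -/
abbrev WLt (x y : ℕ → ℤ) : Prop :=
  @LT.lt (Lex (ℕ → ℤ)) Pi.Lex.linearOrder.toLT (toLex x) (toLex y)

/-- The weak order on words. -/
abbrev WLe (x y : ℕ → ℤ) : Prop :=
  @LE.le (Lex (ℕ → ℤ)) Pi.Lex.linearOrder.toLE (toLex x) (toLex y)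

/-- `x` and `y` agree on their first `k` letters. -/
def Agree (k : ℕ) (x y : ℕ → ℤ) : Prop := ∀ i < k, x i = y i

theorem wlt_iff {x y : ℕ → ℤ} : WLt x y ↔ ∃ k, Agree k x y ∧ x k < y k := Iff.rfl

theorem Agree.mono {k l : ℕ} {x y : ℕ → ℤ} (h : Agree k x y) (hl : l ≤ k) : Agree l x y :=
  fun i hi => h i (by omega)

theorem Agree.symm {k : ℕ} {x y : ℕ → ℤ} (h : Agree k x y) : Agree k y x :=
  fun i hi => (h i hi).symm

theorem Agree.trans {k : ℕ} {x y z : ℕ → ℤ} (h : Agree k x y) (h' : Agree k y z) : Agree k x z :=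
  fun i hi => (h i hi).trans (h' i hi)

theorem Agree.succ {k : ℕ} {x y : ℕ → ℤ} (h : Agree k x y) (h' : x k = y k) :
    Agree (k + 1) x y := by
  intro i hi
  rcases Nat.lt_succ_iff_lt_or_eq.1 hi with h1 | rfl
  exacts [h i h1, h']

theorem WLe.apply_le {k : ℕ} {x y : ℕ → ℤ} (h : WLe x y) (hk : Agree k x y) : x k ≤ y k := by
  by_contra hc
  exact absurd h (not_le.2 (wlt_iff.2 ⟨k, hk.symm, not_le.1 hc⟩))

/-- If `x ≤ a ≤ y` and `x`, `y` agree before `k`, so do `x` and `a`. -/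
theorem Agree.squeeze {k : ℕ} {x a y : ℕ → ℤ} (h : Agree k x y) (h1 : WLe x a) (h2 : WLe a y) :
    Agree k x a := by
  induction k with
  | zero => intro i hi; omega
  | succ k ih =>
    have h3 := ih (h.mono (by omega))
    have h4 := h1.apply_le h3
    have h5 := h2.apply_le (h3.symm.trans (h.mono (by omega)))
    have := h k (by omega)
    exact h3.succ (by omega)

/-- The word `x` without its first `k` letters. -/
def wshift (k : ℕ) (x : ℕ → ℤ) : ℕ → ℤ := fun i => x (k + i)

theorem Agree.wshift_le_iff {k : ℕ} {x y : ℕ → ℤ} (h : Agree k x y) :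
    WLe (wshift k x) (wshift k y) ↔ WLe x y := by
  have key : ∀ {x y : ℕ → ℤ}, Agree k x y → (WLt (wshift k x) (wshift k y) ↔ WLt x y) := by
    intro x y h
    rw [wlt_iff, wlt_iff]
    constructor
    · rintro ⟨l, h1, h2⟩
      refine ⟨k + l, fun i hi => ?_, h2⟩
      by_cases hik : i < k
      · exact h i hik
      · obtain ⟨m, rfl⟩ := Nat.exists_eq_add_of_le (not_lt.1 hik)
        exact h1 m (by omega)
    · rintro ⟨l, h1, h2⟩
      by_cases hlk : l < k
      · exact absurd (h l hlk) h2.ne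
      · obtain ⟨m, rfl⟩ := Nat.exists_eq_add_of_le (not_lt.1 hlk)
        exact ⟨m, fun i hi => h1 (k + i) (by omega), h2⟩
  have := key h.symm
  exact not_lt.symm.trans ((not_congr this).trans not_lt)

theorem Agree.wshift_lt_iff {k : ℕ} {x y : ℕ → ℤ} (h : Agree k x y) :
    WLt (wshift k x) (wshift k y) ↔ WLt x y := by
  have := h.symm.wshift_le_iff
  exact not_le.symm.trans ((not_congr this).trans not_le)

theorem wle_neg_iff {x y : ℕ → ℤ} : WLe (-x) (-y) ↔ WLe y x := by
  have key : ∀ x y : ℕ → ℤ, WLt x y → WLt (-y) (-x) := by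
    rintro x y ⟨k, h1, h2⟩
    exact ⟨k, fun i hi => by simpa using (h1 i hi).symm, by simpa using h2⟩
  refine not_lt.symm.trans ((not_congr ⟨fun h => ?_, key _ _⟩).trans not_lt)
  have := key _ _ h
  rwa [neg_neg, neg_neg] at this

theorem wlt_neg_iff {x y : ℕ → ℤ} : WLt (-x) (-y) ↔ WLt y x := by
  exact not_le.symm.trans ((not_congr wle_neg_iff).trans not_le)

/-- `x` is a word with `N` letters `±1`, continued by zeros. -/
structure IsWord (N : ℕ) (x : ℕ → ℤ) : Prop where
  letter : ∀ i < N, x i = 1 ∨ x i = -1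
  zero : ∀ i, N ≤ i → x i = 0

/-- The suffix of `x` at `r`, negated if the letter preceding it is `1`. -/
def suff (x : ℕ → ℤ) (r : ℕ) : ℕ → ℤ := fun i => -x (r - 1) * x (r + i)

/-- A lexical word: it starts with `1` and exceeds all its proper suffixes. -/
structure IsLexWord (N : ℕ) (x : ℕ → ℤ) : Prop extends IsWord N x where
  head : x 0 = 1
  suff_lt : ∀ r, 1 ≤ r → r ≤ N → WLt (suff x r) x

/-- The word `x` with the signs of all letters from `s` on reversed. -/
def toggle (x : ℕ → ℤ) (s : ℕ) : ℕ → ℤ := fun i => if i < s then x i else -x i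

theorem toggle_lt {x : ℕ → ℤ} {s i : ℕ} (h : i < s) : toggle x s i = x i := by simp [toggle, h]

theorem toggle_ge {x : ℕ → ℤ} {s i : ℕ} (h : s ≤ i) : toggle x s i = -x i := by
  simp [toggle, h]

section word
variable {N : ℕ} {x : ℕ → ℤ}

theorem IsWord.toggle (h : IsWord N x) (s : ℕ) : IsWord N (toggle x s) where
  letter i hi := by
    have := h.letter i hi
    unfold _root_.toggle
    split_ifs <;> omega
  zero i hi := by
    have := h.zero i hi
    unfold _root_.toggle
    split_ifs <;> omega

theorem suff_odd {r : ℕ} (h : x (r - 1) = 1) (i : ℕ) : suff x r i = -x (r + i) := by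
  simp [suff, h]

theorem suff_even {r : ℕ} (h : x (r - 1) = -1) (i : ℕ) : suff x r i = x (r + i) := by
  simp [suff, h]

theorem IsWord.range (h : IsWord N x) (i : ℕ) : x i = 1 ∨ x i = -1 ∨ x i = 0 := by
  by_cases hi : i < N
  · rcases h.letter i hi with h | h <;> simp [h]
  · simp [h.zero i (by omega)]

theorem IsWord.suff (h : IsWord N x) {r : ℕ} (hr : 1 ≤ r) (hrN : r ≤ N) :
    IsWord (N - r) (suff x r) where
  letter i hi := by
    have h2 := h.letter (r + i) (by omega)
    rcases h.letter (r - 1) (by omega) with h1 | h1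
    · rw [suff_odd h1]; omega
    · rw [suff_even h1]; omega
  zero i hi := by simp [_root_.suff, h.zero (r + i) (by omega)]

theorem IsWord.suff_suff (h : IsWord N x) {r m : ℕ} (hr : 1 ≤ r) (hrN : r ≤ N) (hm : 1 ≤ m) :
    _root_.suff (_root_.suff x r) m = _root_.suff x (r + m) := by
  funext i
  have e1 : r + (m - 1) = r + m - 1 := by omega
  have e2 : r + (m + i) = r + m + i := by omega
  rcases h.letter (r - 1) (by omega) with h1 | h1 <;> simp [_root_.suff, h1, e1, e2]

theorem IsWord.suff_ne (h : IsWord N x) {r r' : ℕ} (hr : 1 ≤ r) (hrN : r ≤ N) (hr' : 1 ≤ r')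
    (hrN' : r' ≤ N) (hne : r ≠ r') : toLex (_root_.suff x r) ≠ toLex (_root_.suff x r') := by
  intro he
  have he : _root_.suff x r = _root_.suff x r' := he
  wlog hlt : r < r' generalizing r r'
  · exact this hr' hrN' hr hrN hne.symm he.symm he.symm (by omega)
  have h1 := (h.suff hr hrN).letter (N - r') (by omega)
  have h2 := (h.suff hr' hrN').zero (N - r') (by omega)
  rw [he] at h1
  omega

theorem suff_toggle_gt (x : ℕ → ℤ) {s r : ℕ} (hr : s < r) :
    suff (toggle x s) r = suff x r := by
  funext i
  simp only [suff]
  rw [toggle_ge (by omega), toggle_ge (by omega)]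
  ring

theorem suff_toggle_le (x : ℕ → ℤ) {s r : ℕ} (hr1 : 1 ≤ r) (hr : r ≤ s) :
    suff (toggle x s) r = toggle (suff x r) (s - r) := by
  funext i
  simp only [suff]
  rw [toggle_lt (show r - 1 < s by omega)]
  by_cases hi : r + i < s
  · rw [toggle_lt hi, toggle_lt (show i < s - r by omega), suff]
  · rw [toggle_ge (not_lt.1 hi), toggle_ge (show s - r ≤ i by omega), suff]
    ring

end word

/-- A lexical word does not start with a block followed by the negated block. -/
theorem IsLexWord.trap {N : ℕ} {x : ℕ → ℤ} (h : IsLexWord N x) {e : ℕ} (he : 1 ≤ e)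
    (h1 : x (e - 1) = 1) (h2 : ∀ i < e, x (e + i) = -x i) : False := by
  have hw := h.toIsWord
  have heN : e ≤ N := by
    by_contra hc
    have := hw.zero (e - 1) (by omega)
    omega
  obtain ⟨k, hk1, hk2⟩ := h.suff_lt e he heN
  have hodd := suff_odd h1
  simp only [Pi.toLex_apply, hodd] at hk1 hk2
  have hke : e ≤ k := by
    by_contra hc
    have := h2 k (by omega)
    omega
  have hNe : 2 * e ≤ N := by
    by_contra hc
    have a := hw.zero (2 * e - 1) (by omega)
    have b := h2 (e - 1) (by omega)
    rw [show e + (e - 1) = 2 * e - 1 by omega] at b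
    omega
  have h3 : x (2 * e - 1) = -1 := by
    have b := h2 (e - 1) (by omega)
    rw [show e + (e - 1) = 2 * e - 1 by omega] at b
    omega
  have h4 := h.suff_lt (2 * e) (by omega) hNe
  obtain ⟨l, rfl⟩ := Nat.exists_eq_add_of_le hke
  have hA : Agree l (suff x (2 * e)) x := by
    intro i hi
    rw [suff_even h3]
    have b := hk1 (e + i) (by omega)
    by_cases hie : True
    · have c := hk1 i (by omega)
      rw [show e + (e + i) = 2 * e + i by omega] at b
      omega
    · trivial
  have h5 := WLe.apply_le h4.le hA
  rw [suff_even h3] at h5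
  have c : -x (e + l) = x l := by
    by_cases hl : l < e
    · rw [h2 l hl]; ring
    · exact hk1 l (by omega)
  rw [show e + (e + l) = 2 * e + l by omega] at hk2
  omega

theorem IsWord.lt_of_ne_zero {N : ℕ} {x : ℕ → ℤ} (h : IsWord N x) {i : ℕ} (hi : x i ≠ 0) :
    i < N := by
  by_contra hc
  exact hi (h.zero i (by omega))

theorem suff_of_one {x : ℕ → ℤ} {r : ℕ} (h : x (r - 1) = 1) : suff x r = -wshift r x := by
  funext i
  simp [suff, h, wshift]

theorem suff_of_neg_one {x : ℕ → ℤ} {r : ℕ} (h : x (r - 1) = -1) : suff x r = wshift r x := by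
  funext i
  simp [suff, h, wshift]

/-- A lexical word starting with `w 1 w̄ 1 w̄ (-1)`, where `w 1` has `q` letters, has length
`-1` modulo `q`. -/
theorem IsLexWord.dvd_of_blocks {N : ℕ} {x : ℕ → ℤ} (h : IsLexWord N x) {q : ℕ} (hq : 1 ≤ q)
    (h1 : x (q - 1) = 1) (h2 : ∀ i < q - 1, x (q + i) = -x i) (h3 : x (2 * q - 1) = 1)
    (h4 : ∀ i < q, x (2 * q + i) = -x i) : q ∣ N + 1 := by
  have hw := h.toIsWord
  by_contra hd
  set P : ℕ → ℤ := fun i => if i % q = q - 1 then -1 else x (i % q) with hP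
  have hPs : wshift q P = P := by funext i; simp [wshift, hP]
  have hPx : ∀ i < q - 1, P i = x i := by
    intro i hi
    simp only [hP]
    rw [Nat.mod_eq_of_lt (by omega), if_neg (by omega)]
  have hPl : P (q - 1) = -1 := by
    simp only [hP]
    rw [Nat.mod_eq_of_lt (by omega), if_pos rfl]
  have hPq : ∀ i, P (q + i) = P i := fun i => congrFun hPs i
  have hbase : WLt P (suff x q) := by
    refine wlt_iff.2 ⟨q + (q - 1), ?_, ?_⟩
    · intro i hi
      rw [suff_odd h1]
      by_cases hi1 : i < q - 1
      · rw [hPx i hi1, h2 i hi1]; ring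
      · by_cases hi2 : i = q - 1
        · rw [hi2, hPl, show q + (q - 1) = 2 * q - 1 by omega, h3]
        · obtain ⟨j, rfl⟩ := Nat.exists_eq_add_of_le (show q ≤ i by omega)
          rw [hPq, hPx j (by omega), ← add_assoc, ← two_mul, h4 j (by omega)]; ring
    · rw [suff_odd h1, hPq, hPl, ← add_assoc, ← two_mul, h4 _ (by omega), h1]
      norm_num
  have hqN : q ≤ N := by have := hw.lt_of_ne_zero (i := q - 1) (by omega); omega
  have key : ∀ j, (j + 1) * q ≤ N ∧ WLt P (suff x ((j + 1) * q)) := by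
    intro j
    induction j with
    | zero => simpa using ⟨hqN, hbase⟩
    | succ j ih =>
      obtain ⟨ih1, ih2⟩ := ih
      have e : (j + 1 + 1) * q = (j + 1) * q + q := by ring
      have hpos : 1 ≤ (j + 1) * q := Nat.mul_pos (by omega) hq
      have hlt := h.suff_lt _ hpos ih1
      have hyw := hw.suff hpos ih1
      have hss := hw.suff_suff hpos ih1 hq
      rw [e, ← hss]
      generalize hy : suff x ((j + 1) * q) = y at *
      have hag : Agree (q - 1) P y :=
        Agree.squeeze (y := x) hPx ih2.le hlt.le
      have hag' : Agree (q - 1) y x := hag.symm.trans hPx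
      have hlen : (j + 1) * q + (q - 1) ≤ N := by
        by_cases hq1 : q = 1
        · omega
        · have h5 : y (q - 2) ≠ 0 := by
            rw [hag' (q - 2) (by omega)]
            have := hw.letter (q - 2) (by omega)
            omega
          have := hyw.lt_of_ne_zero h5
          omega
      have hsucc : q - 1 + 1 = q := by omega
      rcases hyw.range (q - 1) with h5 | h5 | h5
      · have hqy : Agree q y x := hsucc ▸ hag'.succ (by omega)
        have h6 := hqy.wshift_lt_iff.2 hlt
        have h7 := hyw.lt_of_ne_zero (i := q - 1) (by omega)
        refine ⟨by omega, ?_⟩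
        rw [suff_of_one h5]
        rw [suff_of_one h1] at hbase
        have := wlt_neg_iff.2 h6
        order
      · have hqy : Agree q P y := hsucc ▸ hag.succ (by omega)
        have h6 := hqy.wshift_lt_iff.2 ih2
        have h7 := hyw.lt_of_ne_zero (i := q - 1) (by omega)
        refine ⟨by omega, ?_⟩
        rwa [suff_of_neg_one h5, ← hPs]
      · exfalso
        have : N ≤ (j + 1) * q + (q - 1) := by
          by_contra hc
          have := hyw.letter (q - 1) (by omega)
          omega
        exact hd ⟨j + 2, by rw [mul_comm]; have : (j + 2) * q = (j + 1) * q + q := by ring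
                            omega⟩
  have := (key N).1
  have : N + 1 ≤ (N + 1) * q := Nat.le_mul_of_pos_right _ hq
  omega

/-- Squeezing with an intermediate word that is only known up to the first `k` letters. -/
theorem Agree.squeeze' {k : ℕ} {x a b y : ℕ → ℤ} (h : Agree k x y) (h1 : WLe x a)
    (hab : Agree k a b) (h2 : WLe b y) : Agree k x a := by
  induction k with
  | zero => intro i hi; omega
  | succ k ih =>
    have h3 := ih (h.mono (by omega)) (hab.mono (by omega))
    have h4 := h1.apply_le h3
    have h5 := h2.apply_le (((hab.mono (by omega)).symm.trans h3.symm).trans (h.mono (by omega)))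
    have := h k (by omega)
    have := hab k (by omega)
    exact h3.succ (by omega)

theorem agree_toggle (x : ℕ → ℤ) (s : ℕ) : Agree s (toggle x s) x := fun _ hi => toggle_lt hi

theorem wshift_toggle (x : ℕ → ℤ) {s k : ℕ} (h : s ≤ k) :
    wshift k (toggle x s) = -wshift k x := by
  funext i
  simp only [wshift, Pi.neg_apply]
  exact toggle_ge (by omega)

theorem wshift_wshift (x : ℕ → ℤ) (k l : ℕ) : wshift k (wshift l x) = wshift (l + k) x := by
  funext i
  simp [wshift, add_assoc]

theorem wshift_neg (x : ℕ → ℤ) (k : ℕ) : wshift k (-x) = -wshift k x := rfl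

theorem IsLexWord.pos {N : ℕ} {x : ℕ → ℤ} (h : IsLexWord N x) : 1 ≤ N :=
  h.toIsWord.lt_of_ne_zero (i := 0) (by rw [h.head]; norm_num)

/-- Criterion for a lexical word to stay lexical after lowering the letter at `s`. -/
theorem IsLexWord.toggle_of_one {N : ℕ} {x : ℕ → ℤ} (h : IsLexWord N x) {s : ℕ} (hs : 1 ≤ s)
    (hsN : s < N) (hxs : x s = 1)
    (hgt : ∀ r, s < r → r ≤ N → WLt (suff x r) (toggle x s))
    (hneg : ∀ e, 1 ≤ e → e ≤ s → x (e - 1) = 1 → Agree (s - e) (suff x e) x →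
      x (s - e) = -1 → False)
    (hpos : ∀ e, 1 ≤ e → e ≤ s → x (e - 1) = 1 → Agree (s - e) (suff x e) x →
      x (s - e) = 1 → WLe (suff x (s + 1)) (-wshift (s - e + 1) (toggle x s)) → False) :
    IsLexWord N (toggle x s) where
  toIsWord := h.toIsWord.toggle s
  head := by rw [toggle_lt (by omega), h.head]
  suff_lt := by
    intro e he heN
    by_cases hes : s < e
    · rw [suff_toggle_gt x hes]
      exact hgt e hes heN
    rw [not_lt] at hes
    rw [suff_toggle_le x he hes]
    obtain ⟨k, hk1, hk2⟩ := wlt_iff.1 (h.suff_lt e he heN)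
    have hag : Agree (s - e) (toggle (suff x e) (s - e)) (suff x e) := agree_toggle _ _
    have hag' : Agree (s - e) (toggle x s) x := (agree_toggle x s).mono (by omega)
    by_cases hks : k < s - e
    · refine wlt_iff.2 ⟨k, ((hag.mono hks.le).trans hk1).trans (hag'.mono hks.le).symm, ?_⟩
      rwa [hag k hks, hag' k hks]
    have hA : Agree (s - e) (suff x e) x := hk1.mono (by omega)
    have hA' := (hag.trans hA).trans hag'.symm
    have hse : e + (s - e) = s := by omega
    have hxm : toggle x s (s - e) = x (s - e) := toggle_lt (by omega)
    rcases h.letter (e - 1) (by omega) with h1 | h1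
    · rcases h.letter (s - e) (by omega) with h2 | h2
      · refine not_le.1 fun hc => ?_
        refine hpos e he hes h1 hA h2 ?_
        have hA'' : Agree (s - e + 1) (toggle (suff x e) (s - e)) (toggle x s) := by
          refine hA'.succ ?_
          rw [toggle_ge le_rfl, suff_odd h1, hse, hxm, hxs, h2]
          norm_num
        have h3 := hA''.symm.wshift_le_iff.2 hc
        rw [wshift_toggle (suff x e) (by omega), suff_of_one h1, wshift_neg, wshift_wshift,
          neg_neg, show e + (s - e + 1) = s + 1 by omega] at h3
        rw [suff_of_one (r := s + 1) (by simpa using hxs)]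
        exact wle_neg_iff.2 h3
      · exact (hneg e he hes h1 hA h2).elim
    · have h2 := WLe.apply_le (h.suff_lt e he heN).le hA
      rw [suff_even h1, hse, hxs] at h2
      refine wlt_iff.2 ⟨s - e, hA', ?_⟩
      rw [toggle_ge le_rfl, suff_even h1, hse, hxs, hxm]
      omega

theorem IsLexWord.suff_of_max {N : ℕ} {x : ℕ → ℤ} (h : IsLexWord N x) {t r : ℕ}
    (htr : t < r) (hrN : r ≤ N)
    (hmax : ∀ r', t < r' → r' ≤ N → WLe (suff x r') (suff x r)) (hh : suff x r 0 = 1) :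
    IsLexWord (N - r) (suff x r) where
  toIsWord := h.toIsWord.suff (by omega) hrN
  head := hh
  suff_lt m hm hmN := by
    rw [h.toIsWord.suff_suff (by omega) hrN hm]
    exact (hmax _ (by omega) (by omega)).lt_of_ne
      (h.toIsWord.suff_ne (by omega) (by omega) (by omega) hrN (by omega))

/-- If the greatest late suffix `V` of `x` comes with a sign change, then `V` is less than
the word obtained from `x` by lowering the letter before `V`, and that word is lexical. -/
theorem IsLexWord.toggle_of_suff_odd {N : ℕ} {x : ℕ → ℤ} (h : IsLexWord N x)
    (hp : (N + 1).Prime) {t r l : ℕ} (ht : 2 ≤ t)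
    (hZ : ∀ e, 1 ≤ e → e ≤ t → x (e - 1) = 1 → Agree (t + 1 - e) (suff x e) x → False)
    (htr : t < r) (hrN : r ≤ N) (hr1 : x (r - 1) = 1)
    (hmax : ∀ r', t < r' → r' ≤ N → WLe (suff x r') (suff x r))
    (htl : t ≤ l) (hl : Agree l (suff x r) x) (hl' : suff x r l < x l) :
    WLt (suff x r) (toggle x (r - 1)) ∧ (t < r - 1 → IsLexWord N (toggle x (r - 1))) := by
  have hw := h.toIsWord
  have hVl : IsLexWord (N - r) (suff x r) :=
    h.suff_of_max htr hrN hmax (by rw [hl 0 (by omega), h.head])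
  have hVw := hVl.toIsWord
  obtain ⟨s, rfl⟩ : ∃ s, r = s + 1 := ⟨r - 1, by omega⟩
  have hVr := suff_odd hr1
  have hVe := suff_of_one hr1
  set V := suff x (s + 1) with hV
  simp only [Nat.add_sub_cancel] at hr1 ⊢
  have hstep : ∀ m, V m = -1 → WLt (wshift (m + 1) V) V := by
    intro m hm
    rw [← suff_of_neg_one (r := m + 1) (by simpa using hm)]
    have := hVw.lt_of_ne_zero (i := m) (by omega)
    exact hVl.suff_lt _ (by omega) (by omega)
  have hi : WLt V (toggle x s) := by
    rcases lt_trichotomy l s with hls | hls | hls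
    · exact wlt_iff.2 ⟨l, hl.trans ((agree_toggle x s).mono hls.le).symm,
        by rwa [toggle_lt hls]⟩
    · subst hls
      rcases hVw.range l with h1 | h1 | h1
      · omega
      · have hA : Agree (l + 1) V (toggle x l) :=
          (hl.trans (agree_toggle x l).symm).succ (by rw [h1, toggle_ge le_rfl, hr1])
        rw [← hA.wshift_lt_iff, wshift_toggle x (by omega), ← hVe]
        exact hstep l h1
      · exfalso
        have h2 : V (l - 1) ≠ 0 := by
          rw [hl (l - 1) (by omega)]
          have := hw.letter (l - 1) (by omega)
          omega
        have h3 := hVw.lt_of_ne_zero h2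
        have h4 : N - (l + 1) ≤ l := by
          by_contra hc
          have := hVw.letter l (by omega)
          omega
        exact Nat.not_prime_mul (a := 2) (b := l + 1) (by omega) (by omega)
          (by rwa [show 2 * (l + 1) = N + 1 by omega])
    · refine (h.trap (e := s + 1) (by omega) (by simpa using hr1) fun i hi => ?_).elim
      have h1 := hl i (by omega)
      rw [hVr] at h1
      omega
  refine ⟨hi, fun hts => ?_⟩
  refine h.toggle_of_one (by omega) (by omega) hr1 ?_ ?_ ?_
  · intro r' hr' hrN'
    exact (hmax r' (by omega) hrN').trans_lt hi
  · intro e he hes he1 hA hm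
    by_cases het : e ≤ t
    · exact hZ e he het he1 (hA.mono (by omega))
    have hYV := hmax e (by omega) (by omega)
    have hYm : suff x e (s - e) = -1 := by
      rw [suff_odd he1, show e + (s - e) = s by omega, hr1]
    have hYs : wshift (s - e + 1) (suff x e) = V := by
      rw [suff_of_one he1, wshift_neg, wshift_wshift, hVe, show e + (s - e + 1) = s + 1 by omega]
    rcases lt_trichotomy (s - e) l with hml | hml | hml
    · have hB : Agree (s - e + 1) (suff x e) V :=
        (hA.trans (hl.mono hml.le).symm).succ (by rw [hYm, hl _ hml, hm])
      have h1 := hB.wshift_le_iff.2 hYV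
      rw [hYs] at h1
      have h2 := hstep (s - e) (by rw [hl _ hml, hm])
      order
    · rw [← hml, hm] at hl'
      have := hVw.range (s - e)
      omega
    · have h1 := hYV.apply_le ((hA.mono hml.le).trans hl.symm)
      rw [hA l hml] at h1
      omega
  · intro e he hes he1 hA hm hX
    rw [← hV] at hX
    by_cases het : e ≤ t
    · exact hZ e he het he1 (hA.mono (by omega))
    have hYV := hmax e (by omega) (by omega)
    have hYm : suff x e (s - e) = -1 := by
      rw [suff_odd he1, show e + (s - e) = s by omega, hr1]
    have hYs : wshift (s - e + 1) (suff x e) = V := by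
      rw [suff_of_one he1, wshift_neg, wshift_wshift, hVe, show e + (s - e + 1) = s + 1 by omega]
    rcases lt_trichotomy (s - e) l with hml | hml | hml
    · have hV1 : V (s - e) = 1 := by rw [hl _ hml, hm]
      have h1 := hVw.lt_of_ne_zero (i := s - e) (by omega)
      have h2 := hVl.suff_lt (s - e + 1) (by omega) (by omega)
      rw [suff_of_one (by simpa using hV1)] at h2
      have h3 := wlt_neg_iff.1 (h2.trans_le hX)
      have hB : Agree (s - e + 1) (toggle x s) V :=
        ((agree_toggle x s).mono (by omega)).trans (hl.mono (by omega)).symm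
      rw [hB.wshift_lt_iff] at h3
      order
    · rw [← hml, hm] at hl'
      rcases hVw.range (s - e) with h1 | h1 | h1
      · omega
      · have hB : Agree (s - e + 1) (suff x e) V :=
          (hA.trans (hl.mono hml.le).symm).succ (by rw [hYm, h1])
        have h2 := hB.wshift_le_iff.2 hYV
        rw [hYs] at h2
        have h3 := hstep (s - e) h1
        order
      · have h2 : V (l - 1) ≠ 0 := by
          rw [hl (l - 1) (by omega)]
          have := hw.letter (l - 1) (by omega)
          omega
        have h3 := hVw.lt_of_ne_zero h2
        have h4 : N - (s + 1) ≤ l := by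
          by_contra hc
          have := hVw.letter l (by omega)
          rw [hml] at h1
          omega
        have hel : l < e := by
          by_contra hc
          refine h.trap he he1 fun i hi => ?_
          have := hA i (by omega)
          rw [suff_odd he1] at this
          omega
        have hpe : l + 1 ≠ e := by
          intro hpe
          exact Nat.not_prime_mul (a := 3) (b := l + 1) (by omega) (by omega)
            (by rwa [show 3 * (l + 1) = N + 1 by omega])
        rw [hml] at hm h1 hX
        have hps := h.suff_lt (l + 1) (by omega) (by omega)
        have hpa : Agree (l + 1) (-wshift (l + 1) (toggle x s)) (suff x (l + 1)) := by
          intro i hi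
          rw [suff_odd (by simpa using hm)]
          simp only [Pi.neg_apply, wshift]
          rw [toggle_lt (by omega)]
        have hsq := hl.squeeze' hX (hpa.mono (by omega)) hps.le
        refine h.trap (e := l + 1) (by omega) (by simpa using hm) fun i hi => ?_
        have h5 := hpa i hi
        have h6 := suff_odd (x := x) (r := l + 1) (by simpa using hm) i
        by_cases hil : i < l
        · have h7 := hsq i hil
          have h8 := hl i hil
          omega
        · obtain rfl : i = l := by omega
          have h7 := hX.apply_le hsq
          have h9 := hw.letter (i + 1 + i) (by omega)
          omega
    · have h1 := hYV.apply_le ((hA.mono hml.le).trans hl.symm)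
      rw [hA l hml] at h1
      omega

theorem IsWord.le_of_eq_zero {N : ℕ} {x : ℕ → ℤ} (h : IsWord N x) {i : ℕ} (hi : x i = 0) :
    N ≤ i := by
  by_contra hc
  have := h.letter i (by omega)
  omega

/-- If the greatest late suffix `U` of `x` comes without a sign change, then lowering the letter
before the greatest sign-changed suffix inside `U` gives a lexical word. -/
theorem IsLexWord.toggle_of_suff_even {N : ℕ} {x : ℕ → ℤ} (h : IsLexWord N x)
    (hp : (N + 1).Prime) {t r l : ℕ} (ht : 2 ≤ t)
    (hZ : ∀ e, 1 ≤ e → e ≤ t → x (e - 1) = 1 → Agree (t + 1 - e) (suff x e) x → False)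
    (htr : t < r) (hrN : r ≤ N) (hr1 : x (r - 1) = -1)
    (hmax : ∀ r', t < r' → r' ≤ N → WLe (suff x r') (suff x r))
    (htl : t ≤ l) (hl : Agree l (suff x r) x) (hl' : suff x r l < x l) :
    ∃ s, t < s ∧ s < N ∧ x s = 1 ∧ IsLexWord N (toggle x s) := by
  have hw := h.toIsWord
  have hUl : IsLexWord (N - r) (suff x r) :=
    h.suff_of_max htr hrN hmax (by rw [hl 0 (by omega), h.head])
  have hUw := hUl.toIsWord
  have hUr := suff_even hr1
  have hUe := suff_of_neg_one hr1
  set U := suff x r with hU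
  obtain ⟨s, hs, hsmax⟩ := Finset.exists_max_image
    ((Finset.range N).filter fun s => r ≤ s ∧ x s = 1)
    (fun s => (toLex (suff x (s + 1)) : Lex (ℕ → ℤ)))
    ⟨r, by
      have h0 := hUr 0
      rw [hUl.head] at h0
      have := hUl.pos
      simp only [Finset.mem_filter, Finset.mem_range]
      exact ⟨by omega, le_rfl, h0.symm⟩⟩
  simp only [Finset.mem_filter, Finset.mem_range] at hs hsmax
  obtain ⟨hsN, hrs, hxs⟩ := hs
  have hXmax : ∀ r', r < r' → x (r' - 1) = 1 → WLe (suff x r') (suff x (s + 1)) := by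
    intro r' h1 h2
    have := hsmax (r' - 1) ⟨hw.lt_of_ne_zero (by omega), by omega, h2⟩
    rwa [show r' - 1 + 1 = r' by omega] at this
  have hXr := suff_odd (x := x) (r := s + 1) (by simpa using hxs)
  have hXe := suff_of_one (x := x) (r := s + 1) (by simpa using hxs)
  have hXw := hw.suff (r := s + 1) (by omega) (by omega)
  have hXU := hmax (s + 1) (by omega) (by omega)
  have hXss := fun m => hw.suff_suff (r := s + 1) (m := m) (by omega) (by omega)
  have hXne : ∀ r', 1 ≤ r' → r' ≤ N → r' ≠ s + 1 → toLex (suff x r') ≠ toLex (suff x (s + 1)) :=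
    fun r' h1 h2 h3 => hw.suff_ne h1 h2 (by omega) (by omega) h3
  set X := suff x (s + 1) with hX
  obtain ⟨G, rfl⟩ : ∃ G, s = r + G := ⟨s - r, by omega⟩
  have hUG : U G = 1 := by rw [hUr, hxs]
  have hXU' : ∀ i, X i = -U (G + 1 + i) := by
    intro i
    rw [hXr, hUr]
    congr 2
    omega
  have hstar : Agree (G + 1) X U → False := by
    intro hA
    refine hUl.trap (e := G + 1) (by omega) (by simpa using hUG) fun i hi => ?_
    have := hA i hi
    have := hXU' i
    omega
  have hstep : ∀ m, X m = -1 → WLt (wshift (m + 1) X) X := by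
    intro m hm
    have h1 := hXss (m + 1) (by omega)
    have h2 := hXw.lt_of_ne_zero (i := m) (by omega)
    rw [← suff_of_neg_one (r := m + 1) (by simpa using hm), h1]
    refine lt_of_le_of_ne (hXmax _ (by omega) ?_) (hXne _ (by omega) (by omega) (by omega))
    have := hXr m
    rw [show r + G + 1 + (m + 1) - 1 = r + G + 1 + m by omega]
    omega
  have hls : l ≤ r + G := by
    by_contra hc
    have h1 : x (r + (r + G)) = 1 := by rw [← hUr, hl _ (by omega), hxs]
    have h2 := hXmax (r + (r + G) + 1) (by omega) (by simpa using h1)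
    rw [suff_of_one (by simpa using h1), hXe, wle_neg_iff] at h2
    have h3 : WLt U x := wlt_iff.2 ⟨l, hl, hl'⟩
    have h4 := (hl.mono (l := r + G + 1) (by omega)).wshift_lt_iff.2 h3
    rw [hUe, wshift_wshift] at h4
    have : r + (r + G + 1) = r + (r + G) + 1 := by omega
    rw [this] at h4
    order
  have hUd : l < r + G → WLt U (toggle x (r + G)) := fun hlt =>
    wlt_iff.2 ⟨l, hl.trans ((agree_toggle x _).mono hlt.le).symm, by rwa [toggle_lt hlt]⟩
  refine ⟨r + G, by omega, hsN, hxs, h.toggle_of_one (by omega) hsN hxs ?_ ?_ ?_⟩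
  · intro r' hr' hrN'
    have hZU := hmax r' (by omega) hrN'
    rcases hls.lt_or_eq with hlt | rfl
    · exact hZU.trans_lt (hUd hlt)
    refine not_le.1 fun hc => ?_
    have hdx := agree_toggle x (r + G)
    have hA : Agree (r + G) (toggle x (r + G)) (suff x r') :=
      (hdx.trans hl.symm).squeeze hc hZU
    have hB : Agree (r + G) (suff x r') U := (hA.symm.trans hdx).trans hl.symm
    rcases hw.letter (r' - 1) (by omega) with h1 | h1
    · exact hstar (((hB.squeeze (hXmax r' (by omega) h1) hXU).symm.trans hB).mono (by omega))
    · have h2 : x (r' + G) = 1 := by rw [← suff_even h1, hB G (by omega), hUG]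
      have h3 := hw.lt_of_ne_zero (i := r' + G) (by omega)
      have h4 := hXmax (r' + G + 1) (by omega) (by simpa using h2)
      have h5 := (hB.mono (l := G + 1) (by omega)).wshift_le_iff.2 hZU
      rw [suff_of_neg_one h1, hUe, wshift_wshift, wshift_wshift, ← wle_neg_iff, ← add_assoc,
        ← add_assoc, ← hXe, ← suff_of_one (r := r' + G + 1) (by simpa using h2)] at h5
      exact hXne _ (by omega) (by omega) (by omega) (le_antisymm h4 h5)
  · intro e he hes he1 hA hm
    by_cases het : e ≤ t
    · exact hZ e he het he1 (hA.mono (by omega))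
    have her : e ≠ r := by rintro rfl; omega
    have hYU := hmax e (by omega) (by omega)
    have hYr := suff_odd he1
    have hYe := suff_of_one he1
    obtain ⟨m, hme⟩ := Nat.exists_eq_add_of_le hes
    rw [show r + G - e = m by omega] at *
    have hYm : suff x e m = -1 := by rw [hYr, ← hme, hxs]
    have hYs : wshift (m + 1) (suff x e) = X := by
      rw [hYe, wshift_neg, wshift_wshift, hXe, hme, add_assoc]
    rcases lt_trichotomy m l with hml | hml | hml
    · have hB : Agree (m + 1) (suff x e) U :=
        (hA.trans (hl.mono hml.le).symm).succ (by rw [hYm, hl _ hml, hm])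
      rcases lt_or_gt_of_ne her with her | her
      · obtain ⟨q, hq⟩ := Nat.exists_eq_add_of_le her.le
        have h1 : x (r + q - 1) = 1 := by
          have := hB (q - 1) (by omega)
          rw [hYr, show e + (q - 1) = r - 1 by omega, hUr,
            show r + (q - 1) = r + q - 1 by omega] at this
          omega
        have hW : Agree (G + 1) (suff x (r + q)) U := by
          intro i hi
          rw [suff_odd h1, add_assoc, ← hUr, ← hB (q + i) (by omega), hYr, hUr, neg_neg, hq,
            add_assoc]
        exact hstar ((hW.squeeze (hXmax _ (by omega) h1) hXU).symm.trans hW)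
      · have h1 := hB.squeeze (hXmax e her he1) hXU
        have h2 := h1.wshift_le_iff.2 (hXmax e her he1)
        rw [hYs] at h2
        have h3 := hstep m (by rw [← h1 m (by omega), hYm])
        order
    · rw [← hml, hm] at hl'
      have := hUw.range m
      omega
    · have h1 := hYU.apply_le ((hA.mono hml.le).trans hl.symm)
      rw [hA l hml] at h1
      omega
  · intro e he hes he1 hA hm hXt
    rw [← hX] at hXt
    by_cases het : e ≤ t
    · exact hZ e he het he1 (hA.mono (by omega))
    have her : e ≠ r := by rintro rfl; omega
    have hYU := hmax e (by omega) (by omega)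
    have hYr := suff_odd he1
    have hYe := suff_of_one he1
    obtain ⟨m, hme⟩ := Nat.exists_eq_add_of_le hes
    rw [show r + G - e = m by omega] at *
    have hYm : suff x e m = -1 := by rw [hYr, ← hme, hxs]
    have hYs : wshift (m + 1) (suff x e) = X := by
      rw [hYe, wshift_neg, wshift_wshift, hXe, hme, add_assoc]
    rcases lt_trichotomy m l with hml | hml | hml
    · have h1 : x (r + m) = 1 := by rw [← hUr, hl _ hml, hm]
      have h2 := hXmax (r + m + 1) (by omega) (by simpa using h1)
      have h2e : suff x (r + m + 1) = -wshift (m + 1) U := by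
        rw [suff_of_one (by simpa using h1), hUe, wshift_wshift, add_assoc]
      rcases hls.lt_or_eq with hlt | hlt
      · have h3 : WLe _ _ := h2.trans hXt
        rw [h2e, wle_neg_iff] at h3
        have hB : Agree (m + 1) (toggle x (r + G)) U :=
          ((agree_toggle x _).mono (by omega)).trans (hl.mono (by omega)).symm
        rw [hB.wshift_le_iff] at h3
        have := hUd hlt
        order
      · have hUd' : Agree (r + G) U (toggle x (r + G)) := (hlt ▸ hl).trans (agree_toggle x _).symm
        have hB : Agree (e - 1) (suff x (r + m + 1)) (-wshift (m + 1) (toggle x (r + G))) := by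
          rw [h2e]
          intro i hi
          simp only [Pi.neg_apply, wshift]
          rw [hUd' _ (by omega)]
        have hC := hB.squeeze h2 hXt
        have hUs : U (r + G) < 1 := by rwa [hlt, hxs] at hl'
        rcases lt_or_gt_of_ne her with her | her
        · have h3 : x (e + r - 1) = 1 := by
            rw [show e + r - 1 = r + (e - 1) by omega, ← hUr, hl _ (by omega), he1]
          have h4 := hXmax (e + r) (by omega) h3
          have hD : Agree m (suff x (e + r)) U := by
            intro i hi
            rw [suff_odd h3, show e + r + i = r + (e + i) by omega, ← hUr, hl _ (by omega), ← hYr,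
              hA i hi, hl _ (by omega)]
          exact hstar (((hD.squeeze h4 hXU).symm.trans hD).mono (by omega))
        · have h3 := hC (r - 1) (by omega)
          rw [h2e, hXr, show r + G + 1 + (r - 1) = r + (r + G) by omega, ← hUr] at h3
          simp only [Pi.neg_apply, wshift] at h3
          rw [hl _ (by omega), show m + 1 + (r - 1) = r + m by omega] at h3
          omega
    · subst hml
      have hUm := hm ▸ hl'
      rcases lt_or_gt_of_ne her with her | her
      · obtain ⟨q, hq⟩ := Nat.exists_eq_add_of_le her.le
        have hq1 : x (q - 1) = 1 := by
          rw [← hA _ (by omega), hYr, show e + (q - 1) = r - 1 by omega, hr1, neg_neg]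
        have h1 : x (r + q - 1) = 1 := by
          rw [show r + q - 1 = r + (q - 1) by omega, ← hUr, hl _ (by omega), hq1]
        have hqU : ∀ i < G, x (q + i) = -U i := by
          intro i hi
          rw [← hA _ (by omega), hYr, hUr, hq, add_assoc]
        have hW : Agree G (suff x (r + q)) U := by
          intro i hi
          rw [suff_odd h1, add_assoc, ← hUr, hl _ (by omega), hqU i hi, neg_neg]
        have hWX := hXmax _ (by omega) h1
        have hE := hW.squeeze hWX hXU
        have hXG := hE.symm.trans hW
        have hWG := hWX.apply_le hE
        have hWG' : suff x (r + q) G = -U m := by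
          rw [suff_odd h1, add_assoc, ← hUr]
          congr 2
          omega
        rcases hXw.range G with h2 | h2 | h2
        · exact hstar (hXG.succ (by rw [h2, hUG]))
        · omega
        · have hUm0 : U m = 0 := by omega
          have hN1 := hUw.le_of_eq_zero hUm0
          have hN2 := hXw.le_of_eq_zero h2
          have hN3 := hUw.lt_of_ne_zero (i := m - 1) (by
            rw [hl _ (by omega)]
            have := hw.letter (m - 1) (by omega)
            omega)
          have hN4 : r + 2 * G + 1 = N := by
            rcases Nat.eq_zero_or_pos G with hG | hG
            · omega
            · have := hXw.lt_of_ne_zero (i := G - 1) (by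
                rw [hXG _ (by omega)]
                have := hUw.letter (G - 1) (by omega)
                omega)
              omega
          have hml : m = 2 * G + 1 := by omega
          have hqG : q = G + 1 := by omega
          have hlt : m < e := by
            by_contra hc
            refine h.trap he he1 fun i hi => ?_
            have := hA i (by omega)
            rw [hYr] at this
            omega
          have hps := h.suff_lt (m + 1) (by omega) (by omega)
          have hpr := suff_odd (x := x) (r := m + 1) (by simpa using hm)
          have hpa : Agree (G + 1) (-wshift (m + 1) (toggle x (r + G))) (suff x (m + 1)) := by
            intro i hi
            rw [hpr]
            simp only [Pi.neg_apply, wshift]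
            rw [toggle_lt (by omega)]
          have hXx : Agree G X x := hXG.trans (hl.mono (by omega))
          have hF := hXx.squeeze' hXt (hpa.mono (by omega)) hps.le
          have hblock : ∀ i < G + 1, x (m + 1 + i) = -x i := by
            intro i hi
            have h5 := hpa i hi
            have h6 := hpr i
            by_cases hil : i < G
            · have h7 := hF i hil
              have h8 := hXx i hil
              omega
            · obtain rfl : i = G := by omega
              have h7 := hXt.apply_le hF
              have h8 := WLe.apply_le hps.le (((hpa.mono (by omega)).symm.trans hF.symm).trans hXx)
              have h9 := hw.letter (m + 1 + i) (by omega)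
              have h10 := hl i (by omega)
              omega
          have hdvd := h.dvd_of_blocks (q := q) (by omega) hq1
            (fun i hi => by rw [hqU i (by omega), hl _ (by omega)])
            (by rw [show 2 * q - 1 = m by omega, hm])
            (fun i hi => by rw [show 2 * q = m + 1 by omega, hblock i (by omega)])
          rcases (Nat.dvd_prime hp).1 hdvd with h11 | h11 <;> omega
      · have hYX := hXmax e her he1
        have hB := (hA.trans hl.symm).squeeze hYX hXU
        have h1 := hYX.apply_le hB
        have h2 := hXU.apply_le (hB.symm.trans (hA.trans hl.symm))
        rcases hXw.range m with h3 | h3 | h3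
        · omega
        · have hC : Agree (m + 1) (suff x e) X := hB.succ (by omega)
          have h4 := hC.wshift_le_iff.2 hYX
          rw [hYs] at h4
          have h5 := hstep m h3
          order
        · have hN1 := hUw.le_of_eq_zero (i := m) (by have := hUw.range m; omega)
          have hN3 := hXw.lt_of_ne_zero (i := m - 1) (by
            rw [← hB _ (by omega), hA _ (by omega)]
            have := hw.letter (m - 1) (by omega)
            omega)
          omega
    · have h1 := hYU.apply_le ((hA.mono hml.le).trans hl.symm)
      rw [hA l hml] at h1
      omega

theorem toggle_lt_self {x : ℕ → ℤ} {s : ℕ} (h : x s = 1) : WLt (toggle x s) x :=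
  wlt_iff.2 ⟨s, agree_toggle x s, by rw [toggle_ge le_rfl, h]; norm_num⟩

theorem lt_toggle_self {x : ℕ → ℤ} {s : ℕ} (h : x s = -1) : WLt x (toggle x s) :=
  wlt_iff.2 ⟨s, (agree_toggle x s).symm, by rw [toggle_ge le_rfl, h]; norm_num⟩

theorem IsLexWord.apply_one {N : ℕ} {x : ℕ → ℤ} (h : IsLexWord N x) : x 1 ≠ -1 := fun h1 =>
  h.trap (e := 1) le_rfl h.head fun i hi => by
    obtain rfl : i = 0 := by omega
    rw [h.head, h1]

/-- Criterion for a lexical word to stay lexical after raising the letter at `s`. -/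
theorem IsLexWord.toggle_of_neg_one {N : ℕ} {x : ℕ → ℤ} (h : IsLexWord N x) {s : ℕ}
    (hs : 1 ≤ s) (hxs : x s = -1)
    (heven : ∀ e, 1 ≤ e → e ≤ s → x (e - 1) = -1 → Agree (s - e) (suff x e) x →
      WLt (toggle (suff x e) (s - e)) (toggle x s)) :
    IsLexWord N (toggle x s) where
  toIsWord := h.toIsWord.toggle s
  head := by rw [toggle_lt (by omega), h.head]
  suff_lt := by
    intro e he heN
    have hlt := h.suff_lt e he heN
    have hup := lt_toggle_self hxs
    by_cases hes : s < e
    · rw [suff_toggle_gt x hes]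
      exact hlt.trans hup
    rw [not_lt] at hes
    rw [suff_toggle_le x he hes]
    rcases h.letter (e - 1) (by omega) with h1 | h1
    · refine (toggle_lt_self ?_).trans (hlt.trans hup)
      rw [suff_odd h1, show e + (s - e) = s by omega, hxs, neg_neg]
    · obtain ⟨k, hk1, hk2⟩ := wlt_iff.1 hlt
      have hag : Agree (s - e) (toggle (suff x e) (s - e)) (suff x e) := agree_toggle _ _
      have hag' : Agree (s - e) (toggle x s) x := (agree_toggle x s).mono (by omega)
      by_cases hks : k < s - e
      · refine wlt_iff.2 ⟨k, ((hag.mono hks.le).trans hk1).trans (hag'.mono hks.le).symm, ?_⟩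
        rwa [hag k hks, hag' k hks]
      · exact heven e he hes h1 (hk1.mono (by omega))

/-- If `A` and `B` agree on a block of length `e` and the words behind that block lie between
them, then `A` is periodic with period `e`. -/
theorem Agree.periodic {e : ℕ} {A B : ℕ → ℤ} (h : Agree e A B) (h1 : WLe A (wshift e A))
    (h2 : WLe (wshift e A) (wshift e B)) (h3 : WLe (wshift e B) B) (k : ℕ) :
    Agree e A (wshift (k * e) A) := by
  have key : WLe A (wshift (k * e) A) ∧ WLe (wshift (k * e) A) (wshift (k * e) B) ∧
      WLe (wshift (k * e) B) B := by
    induction k with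
    | zero =>
      have h0 : ∀ x : ℕ → ℤ, wshift (0 * e) x = x := fun x => by funext i; simp [wshift]
      rw [h0, h0]
      exact ⟨le_rfl, h.wshift_le_iff.1 h2, le_rfl⟩
    | succ k ih =>
      obtain ⟨i1, i2, i3⟩ := ih
      have hA := h.squeeze i1 (i2.trans i3)
      have hB := h.squeeze (i1.trans i2) i3
      have j1 := hA.wshift_le_iff.2 i1
      have j2 := (hA.symm.trans hB).wshift_le_iff.2 i2
      have j3 := (hB.symm.trans h).wshift_le_iff.2 i3
      simp only [wshift_wshift] at j1 j2 j3
      rw [show (k + 1) * e = k * e + e by ring]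
      exact ⟨h1.trans j1, j2, j3.trans h3⟩
  exact h.squeeze key.1 (key.2.1.trans key.2.2)

section successor
variable {N : ℕ} {a g : ℕ → ℤ} {t : ℕ}

theorem IsLexWord.apply_sub_eq_one (hg : IsLexWord N g) (htN : t < N)
    (hag : Agree t a g) (hgt : g t = 1) {e : ℕ} (he : 1 ≤ e) (het : e ≤ t)
    (he1 : a (e - 1) = -1) (hA : Agree (t - e) (suff a e) a) : a (t - e) = 1 := by
  have hge : g (e - 1) = -1 := by rw [← hag _ (by omega), he1]
  have hgA : Agree (t - e) (suff g e) g := by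
    intro i hi
    rw [suff_even hge, ← hag _ (by omega), ← suff_even he1, hA i hi, hag _ (by omega)]
  have h1 := WLe.apply_le (hg.suff_lt e he (by omega)).le hgA
  rw [suff_even hge, show e + (t - e) = t by omega, hgt] at h1
  rw [hag _ (by omega)]
  have := hg.letter (t - e) (by omega)
  omega

/-- When `a < g` branch inside a run of `-1`, raising the end of this run is possible. -/
theorem IsLexWord.toggle_of_run (ha : IsLexWord N a) (hg : IsLexWord N g) (ht : 2 ≤ t)
    (hag : Agree t a g) (hgt : g t = 1) {j : ℕ} (htj : t < j) (hjN : j < N)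
    (hrun : ∀ i, t ≤ i → i ≤ j → a i = -1) (hj : a (j + 1) ≠ -1) :
    IsLexWord N (toggle a j) := by
  refine ha.toggle_of_neg_one (by omega) (hrun j htj.le le_rfl) fun e he hej he1 hA => ?_
  by_cases het : e ≤ t
  · have h1 := hg.apply_sub_eq_one (by omega) hag hgt he het he1 (hA.mono (by omega))
    have h2 := hA (t - e) (by omega)
    rw [suff_even he1, show e + (t - e) = t by omega, hrun t le_rfl htj.le] at h2
    omega
  rcases hej.lt_or_eq with hlt | rfl
  · have h2 := hA 0 (by omega)
    rw [suff_even he1, ha.head, add_zero, hrun e (by omega) hej] at h2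
    omega
  · have h1 := ha.apply_one
    have h2 := ha.letter 1 (by omega)
    have h3 := ha.toIsWord.range (e + 1)
    refine wlt_iff.2 ⟨1, fun i hi => ?_, ?_⟩
    · obtain rfl : i = 0 := by omega
      rw [toggle_ge (by omega), toggle_lt (by omega), suff_even he1, add_zero,
        hrun e htj.le le_rfl, ha.head, neg_neg]
    · rw [toggle_ge (by omega), toggle_lt (by omega), suff_even he1]
      omega

/-- Raising the letter where `a < g` branch is possible if it does not overshoot `g`. -/
theorem IsLexWord.toggle_of_le (ha : IsLexWord N a) (hg : IsLexWord N g) (ht : 1 ≤ t)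
    (htN : t < N) (hag : Agree t a g) (hat : a t = -1) (hgt : g t = 1)
    (hle : WLe (toggle a t) g) : IsLexWord N (toggle a t) := by
  refine ha.toggle_of_neg_one ht hat fun e he het he1 hA => ?_
  have h1 := hg.apply_sub_eq_one htN hag hgt he het he1 hA
  refine not_le.1 fun hc => ?_
  rw [← suff_toggle_le a he het] at hc
  set b := toggle a t with hb
  have hbe : b (e - 1) = -1 := by rw [hb, toggle_lt (by omega), he1]
  have hge : g (e - 1) = -1 := by rw [← hag _ (by omega), he1]
  have hbt : b t = 1 := by rw [hb, toggle_ge le_rfl, hat, neg_neg]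
  have hba : Agree t b a := agree_toggle a t
  have hbg : Agree (t + 1) b g := (hba.trans hag).succ (by rw [hbt, hgt])
  have hete : e + (t - e) = t := by omega
  have hbs : Agree (t - e + 1) (suff b e) b := by
    refine Agree.succ (fun i hi => ?_) ?_
    · rw [suff_even hbe, hba _ (by omega), hba _ (by omega), ← suff_even he1, hA i hi]
    · rw [suff_even hbe, hete, hbt, hba _ (by omega), h1]
  have hgs : Agree (t - e + 1) (suff g e) g := by
    intro i hi
    rw [← hbg i (by omega), suff_even hge, ← hbg _ (by omega), ← suff_even hbe, hbs i hi]
  have hA' : Agree e (wshift (t - e + 1) b) (wshift (t - e + 1) g) := by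
    intro i hi
    exact hbg _ (by omega)
  have h2 := hbs.symm.wshift_le_iff.2 hc
  have h3 := hgs.wshift_le_iff.2 (hg.suff_lt e he (by omega)).le
  have h4 := hbg.wshift_le_iff.2 hle
  rw [suff_of_neg_one hbe] at h2
  rw [suff_of_neg_one hge] at h3
  have h5 : t - e + 1 + e = t + 1 := by omega
  have h6 : e + (t - e + 1) = t + 1 := by omega
  rw [wshift_wshift, h6] at h2 h3
  have h7 := hA'.periodic (by rwa [wshift_wshift, h5])
    (by rwa [wshift_wshift, wshift_wshift, h5]) (by rwa [wshift_wshift, h5]) N (e - 1) (by omega)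
  have h8 : N ≤ N * e := Nat.le_mul_of_pos_right _ he
  simp only [wshift] at h7
  have h9 : b (t - e + 1 + (N * e + (e - 1))) = 0 :=
    (ha.toIsWord.toggle t).zero _ (by omega)
  rw [show t - e + 1 + (e - 1) = t by omega, hbt, h9] at h7
  omega

/-- If raising the letter where `a < g` branch overshoots `g`, then some lexical word lies
strictly between `a` and `g`. -/
theorem IsLexWord.exists_between (ha : IsLexWord N a) (hg : IsLexWord N g)
    (hp : (N + 1).Prime) (ht : 2 ≤ t)
    (hag : Agree t a g) (hat : a t = -1) (hgt : g t = 1)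
    (hlt : WLt g (toggle a t)) : ∃ d, IsLexWord N d ∧ WLt a d ∧ WLt d g := by
  have hga : Agree t (toggle g t) g := agree_toggle g t
  have hAg : Agree (t + 1) a (toggle g t) :=
    (hag.trans hga.symm).succ (by rw [toggle_ge le_rfl, hat, hgt])
  have h1 : WLt a (toggle g t) := by
    have hB : Agree (t + 1) g (toggle a t) :=
      (hag.symm.trans (agree_toggle a t).symm).succ (by rw [toggle_ge le_rfl, hat, hgt, neg_neg])
    have := hB.wshift_lt_iff.2 hlt
    rw [wshift_toggle a (by omega)] at this
    rw [← hAg.wshift_lt_iff, wshift_toggle g (by omega), ← wlt_neg_iff, neg_neg]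
    exact this
  have h2 : WLt (toggle g t) g := toggle_lt_self hgt
  by_contra hno
  have hno : ∀ d, IsLexWord N d → WLt a d → ¬ WLt d g := fun d hd h3 h4 => hno ⟨d, hd, h3, h4⟩
  have hbad : ∃ r, t < r ∧ r ≤ N ∧ WLe (toggle g t) (suff g r) := by
    by_contra hc
    refine hno _ ⟨hg.toIsWord.toggle t, by rw [toggle_lt (by omega), hg.head], ?_⟩ h1 h2
    intro e he heN
    by_cases het : t < e
    · rw [suff_toggle_gt g het]
      exact not_le.1 fun h => hc ⟨e, het, heN, h⟩
    rw [not_lt] at het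
    rcases hg.letter (e - 1) (by omega) with he1 | he1
    · have h3 := (hAg.mono (l := e) (by omega)).wshift_lt_iff.2 h1
      rw [← wlt_neg_iff, ← suff_of_one (by rw [toggle_lt (by omega), he1]),
        ← suff_of_one (by rw [hag _ (by omega), he1])] at h3
      exact h3.trans ((ha.suff_lt e he heN).trans h1)
    · rw [suff_toggle_le g he het]
      obtain ⟨k, hk1, hk2⟩ := wlt_iff.1 (hg.suff_lt e he heN)
      have hag1 : Agree (t - e) (toggle (suff g e) (t - e)) (suff g e) := agree_toggle _ _
      have hag2 : Agree (t - e) (toggle g t) g := hga.mono (by omega)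
      by_cases hks : k < t - e
      · refine wlt_iff.2 ⟨k, ((hag1.mono hks.le).trans hk1).trans (hag2.mono hks.le).symm, ?_⟩
        rwa [hag1 k hks, hag2 k hks]
      · have hA : Agree (t - e) (suff g e) g := hk1.mono (by omega)
        have h3 := WLe.apply_le (hg.suff_lt e he heN).le hA
        rw [suff_even he1, show e + (t - e) = t by omega, hgt] at h3
        refine wlt_iff.2 ⟨t - e, (hag1.trans hA).trans hag2.symm, ?_⟩
        rw [toggle_ge le_rfl, suff_even he1, show e + (t - e) = t by omega, hgt,
          hga _ (by omega)]
        omega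
  obtain ⟨r0, hr0, hr0N, hr0le⟩ := hbad
  obtain ⟨r, hr, hrmax⟩ := Finset.exists_max_image (Finset.Ioc t N)
    (fun r => (toLex (suff g r) : Lex (ℕ → ℤ))) ⟨r0, by simp [hr0, hr0N]⟩
  simp only [Finset.mem_Ioc] at hr hrmax
  obtain ⟨htr, hrN⟩ := hr
  have hmax : ∀ r', t < r' → r' ≤ N → WLe (suff g r') (suff g r) :=
    fun r' h3 h4 => hrmax r' ⟨h3, h4⟩
  have hVle : WLe (toggle g t) (suff g r) := hr0le.trans (hmax r0 hr0 hr0N)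
  have hVlt := hg.suff_lt r (by omega) hrN
  have hVg : Agree t (suff g r) g := (hga.squeeze hVle hVlt.le).symm.trans hga
  obtain ⟨l, hl, hl'⟩ := wlt_iff.1 hVlt
  have htl : t ≤ l := by
    by_contra hc
    have := hVg l (by omega)
    omega
  have hZ : ∀ e, 1 ≤ e → e ≤ t → g (e - 1) = 1 → Agree (t + 1 - e) (suff g e) g → False := by
    intro e he het he1 hA
    have hae : a (e - 1) = 1 := by rw [hag _ (by omega), he1]
    have hA' : Agree (t - e) (suff a e) a := by
      intro i hi
      rw [suff_odd hae, hag _ (by omega), ← suff_odd he1, hA i (by omega), hag _ (by omega)]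
    have h3 := WLe.apply_le (ha.suff_lt e he (by omega)).le hA'
    have h4 := hA (t - e) (by omega)
    rw [suff_odd he1, show e + (t - e) = t by omega, hgt, ← hag _ (by omega)] at h4
    rw [suff_odd hae, show e + (t - e) = t by omega, hat] at h3
    omega
  have hfin : ∀ s, t < s → g s = 1 → ¬ IsLexWord N (toggle g s) := by
    intro s hs hgs hd
    refine hno _ hd (wlt_iff.2 ⟨t, hag.trans ((agree_toggle g s).mono hs.le).symm, ?_⟩)
      (toggle_lt_self hgs)
    rw [toggle_lt hs, hat, hgt]
    norm_num
  rcases hg.letter (r - 1) (by omega) with hr1 | hr1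
  · obtain ⟨h3, h4⟩ := hg.toggle_of_suff_odd hp ht hZ htr hrN hr1 hmax htl hl hl'
    by_cases hrt : t < r - 1
    · exact hfin _ hrt hr1 (h4 hrt)
    · rw [show r - 1 = t by omega] at h3
      order
  · obtain ⟨s, hs, -, hgs, hd⟩ := hg.toggle_of_suff_even hp ht hZ htr hrN hr1 hmax htl hl hl'
    exact hfin s hs hgs hd

end successor

/-- If `g` is the successor of `a` among lexical words of length `N`, with `N + 1` prime, then
raising the last letter of some run of `-1` in `a` gives a lexical word that is at most `g`. -/
theorem IsLexWord.exists_toggle_le {N : ℕ} {a g : ℕ → ℤ} (ha : IsLexWord N a)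
    (hg : IsLexWord N g) (hp : (N + 1).Prime) (hlt : WLt a g)
    (hmin : ∀ d, IsLexWord N d → WLt a d → ¬ WLt d g) :
    ∃ s, 1 ≤ s ∧ s < N ∧ a s = -1 ∧ a (s + 1) ≠ -1 ∧ IsLexWord N (toggle a s) ∧
      WLe (toggle a s) g := by
  obtain ⟨t, hag, ht⟩ := wlt_iff.1 hlt
  have htN : t < N := by
    by_contra hc
    rw [ha.zero t (by omega), hg.zero t (by omega)] at ht
    omega
  have hat : a t = -1 := by
    have := ha.letter t htN
    have := hg.letter t htN
    omega
  have hgt : g t = 1 := by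
    have := hg.letter t htN
    omega
  have ht2 : 2 ≤ t := by
    by_contra hc
    have h0 := ha.head
    have h1 := ha.apply_one
    rcases (show t = 0 ∨ t = 1 by omega) with rfl | rfl <;> omega
  refine ⟨t, by omega, htN, hat, ?_, ?_⟩
  · intro ht1
    have hex : ∃ k, t < k ∧ a k ≠ -1 := ⟨N, htN, by rw [ha.zero N le_rfl]; norm_num⟩
    classical
    obtain ⟨hk1, hk2⟩ := Nat.find_spec hex
    have hk3 := fun m (hm : m < Nat.find hex) => Nat.find_min hex hm
    generalize Nat.find hex = k at *
    have hrun : ∀ i, t ≤ i → i ≤ k - 1 → a i = -1 := by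
      intro i h1 h2
      by_contra hc
      refine hk3 i (by omega) ⟨?_, hc⟩
      rcases h1.lt_or_eq with h | rfl
      exacts [h, (hc hat).elim]
    have hne : k ≠ t + 1 := by rintro rfl; exact hk2 ht1
    have hj := hrun (k - 1) (by omega) le_rfl
    have hjN := ha.toIsWord.lt_of_ne_zero (i := k - 1) (by omega)
    refine hmin _ (ha.toggle_of_run hg ht2 hag hgt (j := k - 1) (by omega) hjN hrun
      (by rwa [show k - 1 + 1 = k by omega])) (lt_toggle_self hj) (wlt_iff.2 ⟨t, ?_, ?_⟩)
    · exact ((agree_toggle a (k - 1)).mono (by omega)).trans hag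
    · rwa [toggle_lt (by omega)]
  · have hle : WLe (toggle a t) g := by
      refine not_lt.1 fun hc => ?_
      obtain ⟨d, h1, h2, h3⟩ := ha.exists_between hg hp ht2 hag hat hgt hc
      exact hmin d h1 h2 h3
    exact ⟨ha.toggle_of_le hg (by omega) htN hag hat hgt hle, hle⟩

/-- The word of a sequence: its entries are the lengths of the runs of `1` and `-1`. -/
def runWord : List ℕ → ℕ → ℤ
  | [] => fun _ => 0
  | a :: l => fun i => if i < a then 1 else -runWord l (i - a)

theorem runWord_cons_lt {a i : ℕ} (l : List ℕ) (h : i < a) : runWord (a :: l) i = 1 := by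
  simp [runWord, h]

theorem runWord_cons_add (a : ℕ) (l : List ℕ) (i : ℕ) :
    runWord (a :: l) (a + i) = -runWord l i := by
  simp [runWord]

theorem wshift_runWord_cons (a : ℕ) (l : List ℕ) :
    wshift a (runWord (a :: l)) = -runWord l := by
  funext i
  exact runWord_cons_add a l i

theorem runWord_append (l m : List ℕ) (i : ℕ) :
    runWord (l ++ m) (l.sum + i) = (-1) ^ l.length * runWord m i := by
  induction l with
  | nil => simp
  | cons a l ih =>
    rw [List.cons_append, List.sum_cons, add_assoc, runWord_cons_add, ih, List.length_cons,
      pow_succ]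
    ring

theorem exists_append_of_lt_sum {α : List ℕ} {i : ℕ} (h : i < α.sum) :
    ∃ l a m j, α = l ++ a :: m ∧ j < a ∧ i = l.sum + j := by
  induction α generalizing i with
  | nil => simp at h
  | cons b α ih =>
    by_cases hi : i < b
    · exact ⟨[], b, α, i, rfl, hi, by simp⟩
    · rw [List.sum_cons] at h
      obtain ⟨l, a, m, j, rfl, hj, h1⟩ := ih (i := i - b) (by omega)
      exact ⟨b :: l, a, m, j, rfl, hj, by rw [List.sum_cons]; omega⟩

theorem neg_one_pow_cases (k : ℕ) : (-1 : ℤ) ^ k = 1 ∨ (-1 : ℤ) ^ k = -1 :=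
  neg_one_pow_eq_or ℤ k

theorem isWord_runWord (α : List ℕ) : IsWord α.sum (runWord α) where
  letter i hi := by
    obtain ⟨l, a, m, j, rfl, hj, rfl⟩ := exists_append_of_lt_sum hi
    rw [runWord_append, runWord_cons_lt m hj, mul_one]
    exact neg_one_pow_cases _
  zero i hi := by
    obtain ⟨j, rfl⟩ := Nat.exists_eq_add_of_le hi
    have := runWord_append α [] j
    rw [List.append_nil] at this
    rw [this]
    simp [runWord]

theorem runWord_zero {α : List ℕ} (h : IsAlphaSeq α) : runWord α 0 = 1 := by
  obtain ⟨h1, h2⟩ := h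
  cases α with
  | nil => exact absurd rfl h1
  | cons a l => exact runWord_cons_lt l (h2 a (by simp))

theorem runWord_zero_nonneg {α : List ℕ} (h : ∀ x ∈ α, 0 < x) : 0 ≤ runWord α 0 := by
  by_cases h0 : α = []
  · simp [h0, runWord]
  · rw [runWord_zero ⟨h0, h⟩]
    norm_num

theorem lexLt_cons {a b : ℕ} {l m : List ℕ} :
    lexLt (a :: l) (b :: m) ↔ a < b ∨ a = b ∧ lexLt m l := by
  have h0 : ∀ a l, Al (a :: l) 0 = a := fun a l => by simp [Al]
  have hs : ∀ a l i, Al (a :: l) (i + 1) = -Al l i := fun a l i => by simp [Al, pow_succ]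
  constructor
  · rintro ⟨i, h1, h2⟩
    cases i with
    | zero =>
      rw [h0, h0] at h2
      exact Or.inl (by exact_mod_cast h2)
    | succ i =>
      have h3 := h1 0 (by omega)
      rw [h0, h0] at h3
      refine Or.inr ⟨by exact_mod_cast h3, i, fun j hj => ?_, ?_⟩
      · have := h1 (j + 1) (by omega)
        rw [hs, hs] at this
        omega
      · rw [hs, hs] at h2
        omega
  · rintro (h | ⟨rfl, i, h1, h2⟩)
    · exact ⟨0, fun j hj => by omega, by rw [h0, h0]; exact_mod_cast h⟩
    · refine ⟨i + 1, fun j hj => ?_, by rw [hs, hs]; omega⟩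
      cases j with
      | zero => rw [h0, h0]
      | succ j => rw [hs, hs, h1 j (by omega)]

theorem runWord_lt_of_lt {a b : ℕ} {l m : List ℕ} (hl : ∀ x ∈ l, 0 < x) (h : a < b) :
    WLt (runWord (a :: l)) (runWord (b :: m)) := by
  refine wlt_iff.2 ⟨a, fun i hi => ?_, ?_⟩
  · rw [runWord_cons_lt l hi, runWord_cons_lt m (by omega)]
  · have h1 := runWord_cons_add a l 0
    have h2 := runWord_zero_nonneg hl
    rw [add_zero] at h1
    rw [runWord_cons_lt m h]
    omega

theorem lexLt_iff {α β : List ℕ} (hα : ∀ x ∈ α, 0 < x) (hβ : ∀ x ∈ β, 0 < x) :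
    lexLt α β ↔ WLt (runWord α) (runWord β) := by
  induction hn : α.length + β.length using Nat.strong_induction_on generalizing α β with
  | _ n ih =>
  cases α with
  | nil =>
    cases β with
    | nil =>
      refine iff_of_false ?_ (lt_irrefl _)
      rintro ⟨i, -, h⟩
      exact lt_irrefl _ h
    | cons b m =>
      have hb := hβ b (by simp)
      refine iff_of_true ⟨0, fun j hj => by omega, by simpa [Al] using hb⟩ ?_
      exact wlt_iff.2 ⟨0, fun j hj => by omega, by rw [runWord_cons_lt m hb]; simp [runWord]⟩
  | cons a l =>
    cases β with
    | nil =>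
      have ha := hα a (by simp)
      refine iff_of_false ?_ ?_
      · rintro ⟨i, h1, h2⟩
        cases i with
        | zero =>
          simp only [Al, List.getD_cons_zero, List.getD_nil] at h2
          omega
        | succ i =>
          have := h1 0 (by omega)
          simp only [Al, List.getD_cons_zero, List.getD_nil] at this
          omega
      · refine (wlt_iff.2 ⟨0, fun j hj => by omega, ?_⟩ : WLt _ _).asymm
        rw [runWord_cons_lt l ha]
        simp [runWord]
    | cons b m =>
      rw [lexLt_cons]
      have hl : ∀ x ∈ l, 0 < x := fun x hx => hα x (by simp [hx])
      have hm : ∀ x ∈ m, 0 < x := fun x hx => hβ x (by simp [hx])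
      rcases lt_trichotomy a b with h | rfl | h
      · exact iff_of_true (Or.inl h) (runWord_lt_of_lt hl h)
      · have hA : Agree a (runWord (a :: l)) (runWord (a :: m)) := fun i hi => by
          rw [runWord_cons_lt l hi, runWord_cons_lt m hi]
        rw [← hA.wshift_lt_iff, wshift_runWord_cons, wshift_runWord_cons, wlt_neg_iff]
        rw [← ih (m.length + l.length) (by simp at hn; omega) hm hl rfl]
        simp
      · refine iff_of_false (by omega) (runWord_lt_of_lt hm h).asymm

theorem suff_runWord {l : List ℕ} (m : List ℕ) (h : IsAlphaSeq l) :
    suff (runWord (l ++ m)) l.sum = runWord m := by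
  obtain ⟨h0, h1⟩ := h
  rcases List.eq_nil_or_concat' l with rfl | ⟨l, b, rfl⟩
  · exact absurd rfl h0
  have hb : 0 < b := h1 b (by simp)
  funext i
  have h2 := runWord_append l (b :: m) (b - 1)
  rw [runWord_cons_lt m (by omega), mul_one] at h2
  have h3 : (l ++ [b]).sum - 1 = l.sum + (b - 1) := by simp; omega
  have h4 := runWord_append (l ++ [b]) m i
  rw [suff, h3, h4, List.append_assoc, List.singleton_append, h2, List.length_append, List.length_singleton, pow_succ]
  rcases neg_one_pow_cases l.length with h5 | h5 <;> rw [h5] <;> ring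

theorem isLexical_iff {α : List ℕ} (hα : IsAlphaSeq α) :
    IsLexical α ↔ IsLexWord α.sum (runWord α) := by
  have hpos := hα.2
  constructor
  · rintro ⟨-, h⟩
    refine ⟨isWord_runWord α, runWord_zero hα, fun r hr hrN => ?_⟩
    have h0 := runWord_zero hα
    rcases hrN.lt_or_eq with hlt | rfl
    · obtain ⟨l, a, m, j, rfl, hj, rfl⟩ := exists_append_of_lt_sum hlt
      rcases Nat.eq_zero_or_pos j with rfl | hj0
      · have hl : l ≠ [] := by rintro rfl; simp at hr
        have h1 := h (l.length + 1) (by have := List.length_pos_iff.2 hl; omega) (by simp)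
        rw [lexLt_iff (fun x hx => hpos x (List.mem_of_mem_drop hx)) hpos] at h1
        simp only [Nat.add_sub_cancel, List.drop_left] at h1
        rw [add_zero, suff_runWord _ ⟨hl, fun x hx => hpos x (by simp [hx])⟩]
        exact h1
      · refine wlt_iff.2 ⟨0, fun i hi => by omega, ?_⟩
        rw [h0, suff, add_zero, runWord_append, Nat.add_sub_assoc hj0, runWord_append,
          runWord_cons_lt m hj, runWord_cons_lt m (by omega)]
        rcases neg_one_pow_cases l.length with h5 | h5 <;> rw [h5] <;> norm_num
    · refine wlt_iff.2 ⟨0, fun i hi => by omega, ?_⟩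
      rw [h0, suff, (isWord_runWord α).zero (α.sum + 0) (by omega)]
      norm_num
  · intro h
    refine ⟨hα, fun i hi hil => ?_⟩
    have h1 : IsAlphaSeq (α.take (i - 1)) := by
      refine ⟨?_, fun x hx => hpos x (List.mem_of_mem_take hx)⟩
      rw [ne_eq, ← List.length_eq_zero_iff, List.length_take]
      omega
    have h2 := suff_runWord (α.drop (i - 1)) h1
    rw [List.take_append_drop] at h2
    rw [lexLt_iff (fun x hx => hpos x (List.mem_of_mem_drop hx)) hpos, ← h2]
    have h3 : (α.take (i - 1)).sum + (α.drop (i - 1)).sum = α.sum := by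
      rw [← List.sum_append, List.take_append_drop]
    refine h.suff_lt _ ?_ (by omega)
    obtain ⟨x, hx⟩ := List.exists_mem_of_ne_nil _ h1.1
    have := h1.2 x hx
    have := List.single_le_sum (fun _ _ => Nat.zero_le _) x hx
    omega

theorem toggle_runWord_append (l m m' : List ℕ) {s : ℕ}
    (h : runWord m' = toggle (runWord m) s) :
    runWord (l ++ m') = toggle (runWord (l ++ m)) (l.sum + s) := by
  induction l with
  | nil => simpa using h
  | cons a l ih =>
    funext i
    simp only [List.cons_append, List.sum_cons]
    by_cases hi : i < a
    · rw [toggle_lt (by omega), runWord_cons_lt _ hi, runWord_cons_lt _ hi]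
    · obtain ⟨j, rfl⟩ := Nat.exists_eq_add_of_le (not_lt.1 hi)
      rw [runWord_cons_add, ih, add_assoc]
      by_cases hj : j < l.sum + s
      · rw [toggle_lt hj, toggle_lt (by omega), runWord_cons_add]
      · rw [toggle_ge (by omega), toggle_ge (by omega), runWord_cons_add]

theorem runWord_split {a : ℕ} (m : List ℕ) (ha : 1 < a) :
    runWord ((a - 1) :: 1 :: m) = toggle (runWord (a :: m)) (a - 1) := by
  funext i
  by_cases hi : i < a - 1
  · rw [toggle_lt hi, runWord_cons_lt _ hi, runWord_cons_lt _ (by omega)]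
  · obtain ⟨j, rfl⟩ := Nat.exists_eq_add_of_le (not_lt.1 hi)
    rw [toggle_ge (by omega), runWord_cons_add]
    cases j with
    | zero => rw [runWord_cons_lt _ (by omega), runWord_cons_lt _ (by omega)]
    | succ j =>
      rw [show j + 1 = 1 + j by omega, runWord_cons_add,
        show a - 1 + (1 + j) = a + j by omega, runWord_cons_add]

theorem runWord_join (b : ℕ) (m : List ℕ) :
    runWord ((b + 1) :: m) = toggle (runWord (b :: 1 :: m)) b := by
  funext i
  by_cases hi : i < b
  · rw [toggle_lt hi, runWord_cons_lt _ hi, runWord_cons_lt _ (by omega)]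
  · obtain ⟨j, rfl⟩ := Nat.exists_eq_add_of_le (not_lt.1 hi)
    rw [toggle_ge (by omega), runWord_cons_add]
    cases j with
    | zero => rw [runWord_cons_lt _ (by omega), runWord_cons_lt _ (by omega), neg_neg]
    | succ j =>
      rw [show j + 1 = 1 + j by omega, runWord_cons_add, neg_neg,
        ← add_assoc, runWord_cons_add]

theorem ElemOpAt.exists_toggle {α α' : List ℕ} {i : ℕ} (h : ElemOpAt α i α') :
    ∃ l a m, α = l ++ a :: m ∧ i = l.length + 1 ∧
      runWord α' = toggle (runWord α) (l.sum + (a - 1)) := by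
  have hdec : ∀ i, i < α.length → α = α.take i ++ α.getD i 0 :: α.drop (i + 1) := by
    intro i hi
    rw [List.getD_eq_getElem _ _ hi, List.cons_getElem_drop_succ, List.take_append_drop]
  rcases h with ⟨⟨h1, h2, h3⟩, rfl⟩ | ⟨⟨h1, h2, h3⟩, rfl⟩
  · have h4 := hdec (i - 1) (by omega)
    rw [show i - 1 + 1 = i by omega] at h4
    refine ⟨_, _, _, h4, by rw [List.length_take]; omega, ?_⟩
    nth_rewrite 2 [h4]
    rw [applyEs, List.append_assoc]
    exact toggle_runWord_append _ _ _ (runWord_split _ h3)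
  · have h4 := hdec (i - 1) (by omega)
    have h5 := hdec (i - 2) (by omega)
    rw [show i - 2 + 1 = i - 1 by omega] at h5
    rw [show i - 1 + 1 = i by omega] at h4
    have h6 : α.drop (i - 1) = 1 :: α.drop i := by
      conv_lhs => rw [h4]
      rw [List.drop_left' (by rw [List.length_take]; omega), h3]
    have h7 : (α.take (i - 1)).sum = (α.take (i - 2)).sum + α.getD (i - 2) 0 := by
      conv_lhs => rw [show i - 1 = i - 2 + 1 by omega, List.take_succ_eq_append_getElem (by omega),
        List.sum_append, List.sum_singleton]
      rw [List.getD_eq_getElem]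
    refine ⟨_, _, _, h4, by rw [List.length_take]; omega, ?_⟩
    rw [h3, h7, Nat.sub_self, add_zero]
    nth_rewrite 2 [h5]
    rw [applyEc, List.append_assoc, h6]
    exact toggle_runWord_append _ _ _ (runWord_join _ _)

theorem exists_elemOpAt {l m : List ℕ} {a : ℕ} (h : IsAlphaSeq (l ++ a :: m)) (hl : l ≠ []) :
    ∃ α', ElemOpAt (l ++ a :: m) (l.length + 1) α' ∧ IsAlphaSeq α' := by
  have hpos := h.2
  have ha := hpos a (by simp)
  have hlen := List.length_pos_iff.2 hl
  rcases (show 1 < a ∨ a = 1 by omega) with ha1 | rfl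
  · refine ⟨_, Or.inl ⟨⟨by omega, by simp, by simpa using ha1⟩, rfl⟩, by simp [applyEs], ?_⟩
    intro x hx
    simp only [applyEs, Nat.add_sub_cancel, List.take_left, List.mem_append, List.mem_cons,
      List.not_mem_nil, or_false] at hx
    rcases hx with (hx | hx | hx) | hx
    · exact hpos x (by simp [hx])
    · rw [hx]; simpa using ha1
    · omega
    · exact hpos x (List.mem_of_mem_drop hx)
  · refine ⟨_, Or.inr ⟨⟨by omega, by simp, by simp⟩, rfl⟩, by simp [applyEc], ?_⟩
    intro x hx
    simp only [applyEc, List.mem_append, List.mem_singleton] at hx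
    rcases hx with (hx | hx) | hx
    · exact hpos x (List.mem_of_mem_take hx)
    · omega
    · exact hpos x (List.mem_of_mem_drop hx)

theorem IsWord.length_unique {N M : ℕ} {x : ℕ → ℤ} (h : IsWord N x) (h' : IsWord M x) :
    N = M := by
  have h1 := h.le_of_eq_zero (h'.zero M le_rfl)
  have h2 := h'.le_of_eq_zero (h.zero N le_rfl)
  omega

theorem finite_isWord (N : ℕ) : {x : ℕ → ℤ | IsWord N x}.Finite := by
  refine (Set.finite_range fun (f : Fin N → Bool) (i : ℕ) =>
    if hi : i < N then (if f ⟨i, hi⟩ then (1 : ℤ) else -1) else 0).subset ?_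
  intro x hx
  refine ⟨fun i => decide (x i = 1), funext fun i => ?_⟩
  by_cases hi : i < N
  · rcases hx.letter i hi with h | h <;> simp [hi, h]
  · simp [hi, hx.zero i (by omega)]

/-- The letters of the run of an even cell are `-1`, in particular the last one. -/
theorem runWord_end {l m : List ℕ} {a : ℕ} (ha : 0 < a) (hl : Even (l.length + 1)) :
    runWord (l ++ a :: m) (l.sum + (a - 1)) = -1 := by
  rw [runWord_append, runWord_cons_lt m (by omega), mul_one]
  have : Odd l.length := by
    rcases Nat.even_or_odd l.length with h | h
    · exact absurd hl (by simpa [Nat.even_add_one] using h)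
    · exact h
  exact this.neg_one_pow

theorem sum_take_succ (l m : List ℕ) (a : ℕ) :
    ((l ++ a :: m).take (l.length + 1)).sum = l.sum + a := by
  simp [List.take_append, List.take_of_length_le]

/-- The end of a run of `-1` that can be raised is a good even cell. -/
theorem exists_goodEvenIndex {α : List ℕ} (hα : IsAlphaSeq α) {s : ℕ} (hs : s < α.sum)
    (h0 : runWord α s = -1) (h1 : runWord α (s + 1) ≠ -1)
    (hlex : IsLexWord α.sum (toggle (runWord α) s)) :
    ∃ k, GoodEvenIndex α k ∧ s < (α.take k).sum := by
  obtain ⟨l, a, m, j, rfl, hj, rfl⟩ := exists_append_of_lt_sum hs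
  rw [runWord_append, runWord_cons_lt m hj, mul_one] at h0
  have hodd : Odd l.length := by
    rcases Nat.even_or_odd l.length with h | h
    · rw [h.neg_one_pow] at h0; omega
    · exact h
  have hja : j = a - 1 := by
    by_contra hc
    rw [add_assoc, runWord_append, runWord_cons_lt m (by omega), mul_one] at h1
    exact h1 h0
  obtain ⟨α', hop, hα'⟩ := exists_elemOpAt hα (by rintro rfl; simp at hodd)
  refine ⟨l.length + 1, ⟨hodd.add_one, α', hop, ?_⟩, ?_⟩
  · obtain ⟨l', a', m', h2, h3, h4⟩ := hop.exists_toggle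
    obtain ⟨rfl, h5⟩ := List.append_inj h2 (by omega)
    obtain ⟨rfl, rfl⟩ := List.cons.inj h5
    rw [isLexical_iff hα']
    rw [← hja] at h4
    rw [h4, ((isWord_runWord α').length_unique (h4 ▸ hlex.toIsWord))]
    exact hlex
  · have := hα.2 a (by simp)
    rw [sum_take_succ]
    omega

theorem WLe.toggle_le_toggle {a : ℕ → ℤ} {s t : ℕ} (h : s ≤ t) (hs : a s = -1) :
    WLe (toggle a t) (toggle a s) := by
  rcases h.eq_or_lt with rfl | h
  · exact le_rfl
  · refine le_of_lt (wlt_iff.2 ⟨s, fun i hi => ?_, ?_⟩)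
    · rw [toggle_lt hi, toggle_lt (by omega)]
    · rw [toggle_lt h, toggle_ge le_rfl, hs]
      norm_num

/-- When `N + 1` is prime, a lexical word `a` below `g` has a run of `-1` whose last letter can be
raised, with the word remaining lexical and not exceeding `g`. -/
theorem IsLexWord.exists_toggle_le_of_lt {N : ℕ} {a g : ℕ → ℤ} (ha : IsLexWord N a)
    (hg : IsLexWord N g) (hp : (N + 1).Prime) (hlt : WLt a g) :
    ∃ s, 1 ≤ s ∧ s < N ∧ a s = -1 ∧ a (s + 1) ≠ -1 ∧ IsLexWord N (toggle a s) ∧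
      WLe (toggle a s) g := by
  have hfin : {x | IsLexWord N x ∧ WLt a x}.Finite :=
    (finite_isWord N).subset fun x hx => hx.1.toIsWord
  obtain ⟨b, ⟨hb, hab⟩, hmin⟩ := Set.exists_min_image (β := Lex (ℕ → ℤ)) _
    (fun x => toLex x) hfin ⟨g, hg, hlt⟩
  obtain ⟨s, h1, h2, h3, h4, h5, h6⟩ := ha.exists_toggle_le hb hp hab
    fun d hd had => not_lt.2 (hmin d ⟨hd, had⟩)
  exact ⟨s, h1, h2, h3, h4, h5, h6.trans (hmin g ⟨hg, hlt⟩)⟩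

/-- for `p` prime, applying the applicable elementary operation at
the largest even index giving a lexical result yields the adjacent successor in `L_p`. -/
theorem stmt_13 (p : ℕ) (hp : Nat.Prime p) (α : List ℕ) (hα : α ∈ Lset p)
    (hng : ¬ GreatestIn (Lset p) α)
    (i : ℕ) (hi : GoodEvenIndex α i) (himax : ∀ j, GoodEvenIndex α j → j ≤ i)
    (α' : List ℕ) (hop : ElemOpAt α i α') (hα' : α' ∈ Lset p) :
    AdjLtIn (Lset p) α α' := by
  have hseq := hα.1.1
  have hseq' := hα'.1.1
  have hlex := (isLexical_iff hseq).1 hα.1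
  have hsum : α.sum + 1 = p := by rw [add_comm]; exact hα.2
  obtain ⟨l, a, m, hdec, rfl, htog⟩ := hop.exists_toggle
  have ha : 0 < a := hseq.2 a (by simp [hdec])
  have hend : runWord α (l.sum + (a - 1)) = -1 := by rw [hdec, runWord_end ha hi.1]
  refine ⟨(lexLt_iff hseq.2 hseq'.2).2 (htog ▸ lt_toggle_self hend), ?_⟩
  rintro γ ⟨hγ, hγsum⟩ ⟨h1, h2⟩
  rw [lexLt_iff hseq.2 hγ.1.2] at h1
  rw [lexLt_iff hγ.1.2 hseq'.2, htog] at h2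
  have hγlex := (isLexical_iff hγ.1).1 hγ
  rw [show γ.sum = α.sum by omega] at hγlex
  obtain ⟨s, -, hsN, hs1, hs2, hs3, hs4⟩ :=
    hlex.exists_toggle_le_of_lt hγlex (hsum ▸ hp) h1
  obtain ⟨k, hk, hsk⟩ := exists_goodEvenIndex hseq hsN hs1 hs2 hs3
  have hle : (α.take k).sum ≤ l.sum + a := by
    rw [← sum_take_succ l m a, ← hdec]
    exact (List.take_sublist_take_left (himax k hk)).sum_le_sum fun _ _ => Nat.zero_le _
  exact not_lt.2 ((WLe.toggle_le_toggle (by omega) hs1).trans hs4) h2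
end

section
/- Let m, d ≥ 2 and n = md. Let g ∈ L_m be fundamental, let λ be the least element of L_d, and suppose α′ = g ⋆ λ ∈ L_n is not the least element of L_n. Then there exists an α-sequence ĝ with D(ĝ) = m − 1 such that (g_e)^{d−1} ĝ belongs to L_n and (g_e)^{d−1} ĝ is adjacent to α′ in L_n with (g_e)^{d−1} ĝ < α′. -/
/-- The order on words over `L = 0 < C = 1 < R = 2`: the first differing letters are compared,
and the comparison is reversed once for each preceding `R`. -/
inductive WordLt : List (Fin 3) → List (Fin 3) → Prop
  | head {a b : Fin 3} {x y : List (Fin 3)} : a < b → WordLt (a :: x) (b :: y)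
  | keep {a : Fin 3} {x y : List (Fin 3)} : a ≠ 2 → WordLt x y → WordLt (a :: x) (a :: y)
  | flip {x y : List (Fin 3)} : WordLt y x → WordLt (2 :: x) (2 :: y)

namespace WordLt

variable {a b : Fin 3} {p x y z w : List (Fin 3)}

@[simp] theorem not_nil_left : ¬ WordLt [] x := by rintro ⟨⟩

@[simp] theorem not_nil_right : ¬ WordLt x [] := by rintro ⟨⟩

theorem cons_cons : WordLt (a :: x) (b :: y) ↔
    a < b ∨ a = b ∧ (a ≠ 2 ∧ WordLt x y ∨ a = 2 ∧ WordLt y x) := by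
  constructor
  · rintro (h | ⟨h, h'⟩ | h)
    · exact Or.inl h
    · exact Or.inr ⟨rfl, Or.inl ⟨h, h'⟩⟩
    · exact Or.inr ⟨rfl, Or.inr ⟨rfl, h⟩⟩
  · rintro (h | ⟨rfl, ⟨h, h'⟩ | ⟨rfl, h⟩⟩)
    · exact head h
    · exact keep h h'
    · exact flip h

theorem irrefl (x : List (Fin 3)) : ¬ WordLt x x := by
  induction x with
  | nil => simp
  | cons a x ih => simp [cons_cons, ih]

theorem trans_aux (h : WordLt x y) :
    (∀ z, WordLt y z → WordLt x z) ∧ (∀ z, WordLt z x → WordLt z y) := by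
  induction h with
  | @head a b x y h =>
    constructor <;> rintro (_ | ⟨c, z⟩) hz
    · simp at hz
    · rw [cons_cons] at hz
      refine head ?_
      rcases hz with hz | ⟨rfl, -⟩
      · exact h.trans hz
      · exact h
    · simp at hz
    · rw [cons_cons] at hz
      refine head ?_
      rcases hz with hz | ⟨rfl, -⟩
      · exact hz.trans h
      · exact h
  | @keep a x y h h' ih =>
    constructor <;> rintro (_ | ⟨c, z⟩) hz
    · simp at hz
    · rw [cons_cons] at hz
      rcases hz with hz | ⟨rfl, ⟨-, hz⟩ | ⟨h2, -⟩⟩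
      · exact head hz
      · exact keep h (ih.1 _ hz)
      · exact absurd h2 h
    · simp at hz
    · rw [cons_cons] at hz
      rcases hz with hz | ⟨rfl, ⟨-, hz⟩ | ⟨h2, -⟩⟩
      · exact head hz
      · exact keep h (ih.2 _ hz)
      · exact absurd h2 h
  | @flip x y h' ih =>
    constructor <;> rintro (_ | ⟨c, z⟩) hz
    · simp at hz
    · rw [cons_cons] at hz
      rcases hz with hz | ⟨rfl, ⟨h2, -⟩ | ⟨-, hz⟩⟩
      · exact head hz
      · exact absurd rfl h2
      · exact flip (ih.2 _ hz)
    · simp at hz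
    · rw [cons_cons] at hz
      rcases hz with hz | ⟨rfl, ⟨h2, -⟩ | ⟨-, hz⟩⟩
      · exact head hz
      · exact absurd rfl h2
      · exact flip (ih.1 _ hz)

theorem trans (h : WordLt x y) (h' : WordLt y z) : WordLt x z := h.trans_aux.1 _ h'

theorem asymm (h : WordLt x y) : ¬ WordLt y x := fun h' => irrefl _ (h.trans h')

theorem append (h : WordLt x y) (z w : List (Fin 3)) : WordLt (x ++ z) (y ++ w) := by
  induction h generalizing z w with
  | head h => exact head h
  | keep h _ ih => exact keep h (ih z w)
  | flip _ ih => exact flip (ih w z)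

theorem append_left (h : WordLt x y) (z : List (Fin 3)) : WordLt (x ++ z) y := by
  simpa using h.append z []

theorem append_right (h : WordLt x y) (z : List (Fin 3)) : WordLt x (y ++ z) := by
  simpa using h.append [] z

theorem trichotomy (x y : List (Fin 3)) :
    x <+: y ∨ y <+: x ∨ WordLt x y ∨ WordLt y x := by
  induction x generalizing y with
  | nil => simp
  | cons a x ih =>
    rcases y with _ | ⟨b, y⟩
    · simp
    · rcases lt_trichotomy a b with h | rfl | h
      · exact Or.inr (Or.inr (Or.inl (head h)))
      · simp only [List.cons_prefix_cons, true_and, cons_cons, lt_irrefl, false_or]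
        have := ih y
        tauto
      · exact Or.inr (Or.inr (Or.inr (head h)))

theorem not_of_prefix (h : x <+: y) : ¬ WordLt x y := by
  obtain ⟨z, rfl⟩ := h
  exact fun h => irrefl _ (h.append_left z)

theorem not_of_prefix' (h : y <+: x) : ¬ WordLt x y := by
  obtain ⟨z, rfl⟩ := h
  exact fun h => irrefl _ (h.append_right z)

theorem append_cancel (p x y : List (Fin 3)) :
    (Even (p.count 2) → (WordLt (p ++ x) (p ++ y) ↔ WordLt x y)) ∧
    (¬ Even (p.count 2) → (WordLt (p ++ x) (p ++ y) ↔ WordLt y x)) := by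
  induction p generalizing x y with
  | nil => simp
  | cons a p ih =>
    by_cases ha : a = 2
    · subst ha
      simp only [List.count_cons_self, Nat.even_add_one, List.cons_append, cons_cons]
      have := ih y x
      simp only [lt_irrefl, ne_eq, not_true_eq_false, false_and, true_and, false_or, not_not]
      tauto
    · simp only [List.cons_append, cons_cons, List.count_cons_of_ne ha]
      have := ih x y
      simp only [lt_irrefl, ha, ne_eq, not_false_eq_true, false_and, true_and, false_or, or_false]
      tauto

theorem append_even (h : Even (p.count 2)) : WordLt (p ++ x) (p ++ y) ↔ WordLt x y :=
  (append_cancel p x y).1 h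

theorem append_odd (h : ¬ Even (p.count 2)) : WordLt (p ++ x) (p ++ y) ↔ WordLt y x :=
  (append_cancel p x y).2 h

/-- A strict inequality is decided within the shorter word. -/
theorem of_append_right (h : WordLt x (y ++ z)) (hl : x.length ≤ y.length) : WordLt x y := by
  rcases trichotomy x y with h' | h' | h' | h'
  · exact absurd h (not_of_prefix (h'.trans (List.prefix_append _ _)))
  · obtain rfl := h'.eq_of_length (le_antisymm h'.length_le hl)
    exact absurd h (not_of_prefix (List.prefix_append _ _))
  · exact h'
  · exact absurd (h'.append_left z) h.asymm

end WordLt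

/-- A word is `Dominant` if it strictly exceeds each of its proper nonempty suffixes. -/
def Dominant (z : List (Fin 3)) : Prop :=
  ∀ x y, z = x ++ y → x ≠ [] → y ≠ [] → WordLt y z

theorem eq_zero_or_two_of_ne_one {c : Fin 3} (h : c ≠ 1) : c = 0 ∨ c = 2 := by
  revert c; decide

namespace WordLt

variable {x y z : List (Fin 3)}

theorem two_cons_iff : WordLt (2 :: x) (2 :: y) ↔ WordLt y x := by
  simp [cons_cons]

theorem not_two_two (h : ∀ ρ, 2 :: ρ <:+ 2 :: z → WordLt (2 :: ρ) (2 :: 2 :: z)) : False := by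
  have aux : ∀ ρ, ¬ 2 :: ρ <:+ 2 :: z := by
    intro ρ
    induction ρ with
    | nil => exact fun hs => not_nil_right (two_cons_iff.1 (h _ hs))
    | cons c ρ ih =>
      intro hs
      have hlt := two_cons_iff.1 (h _ hs)
      rw [cons_cons] at hlt
      obtain hlt | ⟨rfl, -⟩ := hlt
      · exact absurd hlt (not_lt.2 (Fin.le_last c))
      · exact ih ((List.suffix_cons _ _).trans hs)
  exact aux z List.suffix_rfl

end WordLt

variable {g : List (Fin 3)} {b : Fin 3}

theorem Dominant.suffix_dichotomy (hmax : Dominant (g ++ [1])) (h1 : 1 ∉ g) (hb : b ≠ 1)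
    {x w : List (Fin 3)} (hG : g ++ [b] = x ++ w) (hx : x ≠ []) (hw : w ≠ []) :
    WordLt w (g ++ [b]) ∨ (w <+: g ++ [b] ∧ ¬ Even (w.count 2)) := by
  obtain ⟨w, c, rfl⟩ := List.eq_nil_or_concat' w |>.resolve_left hw
  rw [← List.append_assoc] at hG
  obtain ⟨rfl, hc⟩ := List.append_inj' hG rfl
  obtain rfl : b = c := by simpa using hc
  clear hG hc hw
  have hlt := hmax x (w ++ [1]) (by simp) hx (by simp)
  rcases WordLt.trichotomy w (x ++ w) with h | h | h | h
  · obtain ⟨r, hr⟩ := h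
    rw [← hr] at hlt ⊢
    have hr1 : 1 ∉ r := fun h => h1 (by rw [← hr]; simp [h])
    rcases r with _ | ⟨c, r⟩
    · have := congrArg List.length hr
      simp at this
      exact absurd this hx
    have hc1 : c ≠ 1 := fun h => hr1 (by simp [h])
    simp only [List.append_assoc, List.cons_append] at hlt ⊢
    by_cases hev : Even (w.count 2)
    · rw [WordLt.append_even hev] at hlt ⊢
      rcases eq_zero_or_two_of_ne_one hc1 with rfl | rfl <;>
      rcases eq_zero_or_two_of_ne_one hb with rfl | rfl <;>
      simp_all [WordLt.cons_cons]
    · rw [WordLt.append_odd hev] at hlt ⊢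
      rcases eq_zero_or_two_of_ne_one hc1 with rfl | rfl <;>
      rcases eq_zero_or_two_of_ne_one hb with rfl | rfl <;>
      simp_all [WordLt.cons_cons]
  · have := h.length_le
    simp at this
    exact absurd this hx
  · exact Or.inl (h.append _ _)
  · exact absurd (h.append [1] [1]) hlt.asymm

/-- `s ++ (e ++ s)` behaves like the even modification of a lexical word whose longest border
is `s`. -/
structure Bordered (s e : List (Fin 3)) : Prop where
  dich : ∀ x w, s ++ (e ++ s) = x ++ w → x ≠ [] → w ≠ [] →
    WordLt w (s ++ (e ++ s)) ∨ (w <+: s ++ (e ++ s) ∧ ¬ Even (w.count 2))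
  long : ∀ x w, s ++ (e ++ s) = x ++ w → x ≠ [] → s.length < w.length →
    WordLt w (s ++ (e ++ s))
  odd : ¬ Even (s.count 2)
  even : Even (e.count 2)
  ne_nil : e ≠ []
  one_notMem : 1 ∉ e
  one_notMem' : 1 ∉ s

namespace Bordered

variable {s e : List (Fin 3)}

theorem left_ne_nil (h : Bordered s e) : s ≠ [] := by
  rintro rfl
  exact h.odd (by simp)

theorem not_even_suffix (h : Bordered s e) {e₀ e₁ : List (Fin 3)} (he : e = e₀ ++ e₁)
    (hne : e₁ ≠ []) (hev : Even (e₁.count 2)) : ¬ e₁ <+: s ++ (e ++ s) := by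
  rintro ⟨G, hG⟩
  have hlt : WordLt (e₁ ++ s) (s ++ (e ++ s)) :=
    h.long (s ++ e₀) _ (by simp [he]) (by simp [h.left_ne_nil])
      (by simpa using List.length_pos_iff.2 hne)
  rw [← hG, WordLt.append_even hev] at hlt
  have hG0 : G ≠ [] := by
    rintro rfl
    simp at hlt
  have hs : s <+: s ++ (e ++ s) := List.prefix_append _ _
  rcases h.dich e₁ G hG.symm hne hG0 with h' | ⟨h', -⟩
  · exact WordLt.not_of_prefix hs (hlt.trans h')
  · rcases List.prefix_or_prefix_of_prefix hs h' with h' | h'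
    · exact WordLt.not_of_prefix h' hlt
    · exact WordLt.not_of_prefix' h' hlt

theorem no_square_prefix (h : Bordered s e) (n : ℕ) : ∀ P c : List (Fin 3), c.length ≤ n →
    (P = [] ∨ s <+: P) → P ++ s = s ++ P → s ++ (e ++ s) ≠ s ++ (s ++ (P ++ (c ++ s))) := by
  induction n with
  | zero =>
    intro P c hc hP hcomm heq
    obtain rfl := List.length_eq_zero_iff.1 (Nat.le_zero.1 hc)
    have hlt := h.long (s ++ P) (s ++ s)
      (by rw [heq, List.nil_append, List.append_assoc, ← List.append_assoc P, hcomm,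
        List.append_assoc, hcomm])
      (by simp [h.left_ne_nil]) (by simpa using List.length_pos_iff.2 h.left_ne_nil)
    rw [heq] at hlt
    exact WordLt.not_of_prefix ⟨P ++ ([] ++ s), by simp⟩ hlt
  | succ n ih =>
    intro P c hc hP hcomm heq
    by_cases hc0 : c = []
    · subst hc0
      exact ih P [] (by simp) hP hcomm heq
    have hs := List.length_pos_iff.2 h.left_ne_nil
    have hcomm' : ∀ z, P ++ (s ++ z) = s ++ (P ++ z) := fun z => by
      rw [← List.append_assoc, hcomm, List.append_assoc]
    have h1 := h.long (s ++ (s ++ P)) (c ++ s) (by rw [heq]; simp) (by simp [h.left_ne_nil])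
      (by simpa using List.length_pos_iff.2 hc0)
    have h2 := h.long (s ++ P) (s ++ (c ++ s))
      (by simp only [heq, List.append_assoc, hcomm'])
      (by simp [h.left_ne_nil]) (by simp; omega)
    rw [heq] at h1 h2
    rw [WordLt.append_odd h.odd] at h2
    rcases WordLt.trichotomy c s with h' | ⟨c, rfl⟩ | h' | h'
    · have hl := h'.length_le
      have hcP : c <+: P ++ (c ++ s) := by
        rcases hP with rfl | hP
        · simp
        · exact (h'.trans hP).trans (List.prefix_append _ _)
      obtain ⟨q, hq⟩ := hcP
      rw [← List.append_assoc] at h1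
      have h1' := WordLt.of_append_right h1 (by simp [hl])
      obtain ⟨r, hr⟩ := h'
      have h1'' : WordLt (c ++ s) (s ++ c) :=
        WordLt.of_append_right (z := r) (by rwa [List.append_assoc, hr]) (by simp; omega)
      rw [← hq, ← List.append_assoc] at h2
      exact (h1''.append_right q).asymm h2
    · refine ih (P ++ s) c ?_ (Or.inr (by simp [hcomm])) (by rw [hcomm, List.append_assoc, hcomm])
        (by rw [heq]; simp)
      simp at hc
      omega
    · exact (h'.append _ _).asymm h2
    · exact (h'.append _ _).asymm h1

theorem lt (h : Bordered s e) : WordLt e s := by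
  rcases WordLt.trichotomy e s with h' | ⟨c, rfl⟩ | h' | h'
  · exact absurd (h'.trans (List.prefix_append _ _))
      (h.not_even_suffix (e₀ := []) rfl h.ne_nil h.even)
  · exact absurd (by simp) (h.no_square_prefix c.length [] c le_rfl (Or.inl rfl) (by simp))
  · exact h'
  · exact absurd (h.long s (e ++ s) rfl h.left_ne_nil
      (by simpa using List.length_pos_iff.2 h.ne_nil)) (h'.append _ _).asymm

theorem lt_of_border (h : Bordered s e) {w f : List (Fin 3)} (hs : s = w ++ f) (hw : w ≠ [])
    (hf : f ≠ []) (hodd : ¬ Even (w.count 2)) : WordLt f s := by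
  rcases h.dich (s ++ (e ++ w)) f (by rw [hs]; simp) (by simp [hw]) hf with h' | ⟨-, h'⟩
  · exact WordLt.of_append_right h' (by simp [hs])
  · have := h.odd
    rw [hs, List.count_append] at this
    grind

theorem lt_dropLast (h : Bordered s e) {e' : List (Fin 3)} {x : Fin 3} (he : e = e' ++ [x]) :
    WordLt (e ++ s) (e' ++ [1]) := by
  have hev := h.even
  have hx : x ≠ 1 := by
    rintro rfl
    exact h.one_notMem (by simp [he])
  rw [he, List.count_append] at hev
  rw [he, List.append_assoc]
  by_cases hc : Even (e'.count 2)
  · rw [WordLt.append_even hc]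
    rcases eq_zero_or_two_of_ne_one hx with rfl | rfl <;>
    simp_all [WordLt.cons_cons, Nat.even_add_one]
  · rw [WordLt.append_odd hc]
    rcases eq_zero_or_two_of_ne_one hx with rfl | rfl
    · exact absurd (by simpa using hev) hc
    · simp [WordLt.cons_cons]

/-- A border of `s ++ (e ++ s)` is a prefix of `s`. -/
theorem prefix_of_border (h : Bordered s e) {x w : List (Fin 3)} (hx : x ≠ [])
    (hG : s ++ (e ++ s) = x ++ w) (hw : w <+: s ++ (e ++ s)) : w <+: s := by
  refine List.prefix_of_prefix_length_le hw (List.prefix_append _ _) ?_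
  by_contra! hl
  exact WordLt.not_of_prefix hw (h.long x w hG hx hl)

theorem tail_lt (h : Bordered s e) (e' : List (Fin 3)) :
    WordLt (s ++ (s ++ (e' ++ [1]))) (s ++ (e ++ s)) := by
  rw [WordLt.append_odd h.odd]
  exact h.lt.append _ _

theorem suffix_append_tail_lt (h : Bordered s e) {e' x w Y : List (Fin 3)}
    (hG : s ++ (e ++ s) = x ++ w) (hx : x ≠ []) (hw : w ≠ [])
    (hY : Y = s ++ (s ++ (e' ++ [1])) ∨ s ++ (e ++ s) <+: Y) :
    WordLt (w ++ Y) (s ++ (e ++ s)) := by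
  rcases h.dich x w hG hx hw with h' | ⟨h', hodd⟩
  · exact h'.append_left _
  · obtain ⟨f, hf⟩ := h.prefix_of_border hx hG h'
    have hlt : WordLt (f ++ (e ++ s)) (s ++ (e ++ s)) := by
      refine h.long w _ (by simp [← hf]) hw ?_
      have := List.length_pos_iff.2 h.ne_nil
      simp; omega
    nth_rw 1 [← hf]
    rw [List.append_assoc, WordLt.append_odd hodd]
    rcases hY with rfl | ⟨z, rfl⟩
    · by_cases hf0 : f = []
      · subst hf0
        exact h.lt.append _ _
      · exact (h.lt_of_border hf.symm hw hf0 hodd).append _ _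
    · exact hlt.append_right _

theorem tail_suffix_lt (h : Bordered s e) {e' x y : List (Fin 3)} {c : Fin 3}
    (he : e = e' ++ [c]) (hT : s ++ (s ++ (e' ++ [1])) = x ++ y) (hx : x ≠ []) (hy : y ≠ []) :
    WordLt y (s ++ (e ++ s)) := by
  have border : ∀ x w, s = x ++ w → x ≠ [] → w ≠ [] → WordLt w (s ++ (e ++ s)) ∨
      ∃ f, s = w ++ f ∧ f ≠ [] ∧ ¬ Even (w.count 2) := by
    intro x w hs hx hw
    have hG : s ++ (e ++ s) = (s ++ (e ++ x)) ++ w := by nth_rw 2 [hs]; simp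
    rcases h.dich _ w hG (by simp [hx]) hw with h' | ⟨h', hodd⟩
    · exact Or.inl h'
    · obtain ⟨f, hf⟩ := h.prefix_of_border (by simp [hx]) hG h'
      refine Or.inr ⟨f, hf.symm, ?_, hodd⟩
      rintro rfl
      have := congrArg List.length (hf.trans hs)
      simp at this
      exact hx this
  have last : ∀ x y, e' ++ [1] = x ++ y → y ≠ [] → WordLt y (s ++ (e ++ s)) := by
    intro x y hT hy
    obtain ⟨y, d, rfl⟩ := List.eq_nil_or_concat' y |>.resolve_left hy
    rw [← List.append_assoc] at hT
    obtain ⟨rfl, hd⟩ := List.append_inj' hT rfl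
    obtain rfl : 1 = d := by simpa using hd
    have hc : c ≠ 1 := by
      rintro rfl
      exact h.one_notMem (by simp [he])
    have hlt : WordLt (y ++ c :: s) (s ++ (e ++ s)) :=
      h.long (s ++ x) _ (by simp [he]) (by simp [h.left_ne_nil]) (by simp; omega)
    rcases WordLt.trichotomy y (s ++ (e ++ s)) with h' | h' | h' | h'
    · obtain ⟨r, hr⟩ := h'
      rcases r with _ | ⟨a, r⟩
      · have := congrArg List.length hr
        simp [he] at this
        omega
      have ha : a ≠ 1 := by
        rintro rfl
        have : (1 : Fin 3) ∈ s ++ (e ++ s) := by rw [← hr]; simp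
        simp [h.one_notMem, h.one_notMem'] at this
      have hA : a = c → ¬ Even ((y ++ [c]).count 2) := by
        rintro rfl hev
        exact h.not_even_suffix (e₀ := x) (e₁ := y ++ [a]) (by simp [he]) (by simp) hev
          ⟨r, by simp [← hr]⟩
      rw [← hr] at hlt ⊢
      by_cases hev : Even (y.count 2)
      · rw [WordLt.append_even hev] at hlt ⊢
        rcases eq_zero_or_two_of_ne_one ha with rfl | rfl <;>
        rcases eq_zero_or_two_of_ne_one hc with rfl | rfl <;>
        simp_all [WordLt.cons_cons]
      · rw [WordLt.append_odd hev] at hlt ⊢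
        rcases eq_zero_or_two_of_ne_one ha with rfl | rfl <;>
        rcases eq_zero_or_two_of_ne_one hc with rfl | rfl <;>
        simp_all [WordLt.cons_cons]
    · have := h'.length_le
      simp [he] at this
      omega
    · exact h'.append_left _
    · exact absurd hlt (h'.append_right _).asymm
  have middle : ∀ x y, s ++ (e' ++ [1]) = x ++ y → y ≠ [] → WordLt y (s ++ (e ++ s)) := by
    intro x y hT hy
    rcases List.append_eq_append_iff.1 hT with ⟨a, rfl, ha⟩ | ⟨w, hs, rfl⟩
    · exact last a y ha hy
    · by_cases hx : x = []
      · obtain rfl : s = w := by simpa [hx] using hs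
        rw [WordLt.append_odd h.odd]
        exact h.lt_dropLast he
      by_cases hw : w = []
      · subst hw
        exact last [] _ rfl hy
      rcases border x w hs hx hw with h' | ⟨f, hf, hf0, hodd⟩
      · exact h'.append_left _
      · have hlt := h.long x (w ++ (e ++ s)) (by nth_rw 1 [hs]; simp) hx
          (by have := List.length_pos_iff.2 h.ne_nil; simp; omega)
        nth_rw 1 [hf]
        nth_rw 2 [hf] at hlt
        rw [List.append_assoc, WordLt.append_odd hodd] at hlt ⊢
        exact hlt.trans (h.lt_dropLast he)
  rcases List.append_eq_append_iff.1 hT with ⟨a, rfl, ha⟩ | ⟨w, hs, rfl⟩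
  · exact middle a y ha hy
  · by_cases hw : w = []
    · subst hw
      exact middle [] _ rfl hy
    rcases border x w hs hx hw with h' | ⟨f, hf, hf0, hodd⟩
    · exact h'.append_left _
    · nth_rw 2 [hf]
      rw [List.append_assoc, WordLt.append_odd hodd]
      exact (h.lt_of_border hf hw hf0 hodd).append _ _

end Bordered

/-- The `k`-fold concatenation of a word. -/
def wordPow (G : List (Fin 3)) (k : ℕ) : List (Fin 3) := (List.replicate k G).flatten

@[simp] theorem wordPow_zero (G : List (Fin 3)) : wordPow G 0 = [] := rfl

theorem wordPow_succ (G : List (Fin 3)) (k : ℕ) : wordPow G (k + 1) = G ++ wordPow G k := by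
  simp [wordPow, List.replicate_succ]

theorem wordPow_add (G : List (Fin 3)) (j k : ℕ) :
    wordPow G (j + k) = wordPow G j ++ wordPow G k := by
  rw [wordPow, List.replicate_add, List.flatten_append, wordPow, wordPow]

theorem even_count_wordPow {G : List (Fin 3)} (hG : Even (G.count 2)) (k : ℕ) :
    Even ((wordPow G k).count 2) := by
  induction k with
  | zero => simp
  | succ k ih => simpa [wordPow_succ, Nat.even_add, hG] using ih

theorem dominant_wordPow_append {G T : List (Fin 3)} (hG : Even (G.count 2))
    (hA : WordLt T G)
    (hB : ∀ j x w, G = x ++ w → x ≠ [] → w ≠ [] → WordLt (w ++ (wordPow G j ++ T)) G)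
    (hC : ∀ x y, T = x ++ y → x ≠ [] → y ≠ [] → WordLt y G) (k : ℕ) (hk : k ≠ 0) :
    Dominant (wordPow G k ++ T) := by
  have aux : ∀ k x y, wordPow G k ++ T = x ++ y → x ≠ [] → y ≠ [] →
      WordLt y G ∨ ∃ j < k, y = wordPow G j ++ T := by
    intro k
    induction k with
    | zero => exact fun x y h hx hy => Or.inl (hC x y h hx hy)
    | succ k ih =>
      intro x y h hx hy
      rw [wordPow_succ, List.append_assoc] at h
      rcases List.append_eq_append_iff.1 h with ⟨a, rfl, ha⟩ | ⟨w, hw, rfl⟩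
      · by_cases ha0 : a = []
        · subst ha0
          exact Or.inr ⟨k, by simp, ha.symm⟩
        · rcases ih a y ha ha0 hy with h' | ⟨j, hj, rfl⟩
          · exact Or.inl h'
          · exact Or.inr ⟨j, by omega, rfl⟩
      · by_cases hw0 : w = []
        · subst hw0
          exact Or.inr ⟨k, by simp, rfl⟩
        · exact Or.inl (hB k x w hw hx hw0)
  intro x y h hx hy
  rcases aux k x y h hx hy with h' | ⟨j, hj, rfl⟩
  · obtain ⟨k, rfl⟩ := Nat.exists_eq_succ_of_ne_zero hk
    rw [Nat.succ_eq_add_one, wordPow_succ, List.append_assoc]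
    exact h'.append_right _
  · obtain ⟨i, rfl⟩ := Nat.exists_eq_add_of_lt hj
    rw [Nat.add_assoc, wordPow_add, List.append_assoc,
      WordLt.append_even (even_count_wordPow hG j), wordPow_succ, List.append_assoc]
    exact hA.append_right _

theorem replicate_two_lt (n : ℕ) (z : List (Fin 3)) :
    WordLt (List.replicate n 2 ++ [1]) (2 :: 0 :: z) := by
  rcases n with _ | _ | n <;> simp [List.replicate_succ, WordLt.cons_cons]

/-- Every power of `G` is completed to a dominant word by a word `v ++ [1]`, smaller than `G` and of
the same length. -/
theorem exists_tail {G : List (Fin 3)} (h1 : 1 ∉ G) (hev : Even (G.count 2))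
    (hdich : ∀ x w, G = x ++ w → x ≠ [] → w ≠ [] →
      WordLt w G ∨ (w <+: G ∧ ¬ Even (w.count 2)))
    (h2 : ∃ z, G = 2 :: z) (hl : 3 ≤ G.length) (hsq : ∀ s, G ≠ s ++ s) (k : ℕ) (hk : k ≠ 0) :
    ∃ v, v.length + 1 = G.length ∧ 1 ∉ v ∧ (∃ z, v = 2 :: z) ∧
      WordLt (v ++ [1]) G ∧ Dominant (wordPow G k ++ (v ++ [1])) := by
  by_cases hb : ∀ x w, G = x ++ w → x ≠ [] → w ≠ [] → WordLt w G
  · obtain ⟨z, rfl⟩ : ∃ z, G = 2 :: 0 :: z := by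
      obtain ⟨_ | ⟨c, z⟩, rfl⟩ := h2
      · simp at hl
      have hc : c ≠ 1 := by
        rintro rfl
        simp at h1
      rcases eq_zero_or_two_of_ne_one hc with rfl | rfl
      · exact ⟨z, rfl⟩
      · refine (WordLt.not_two_two (z := z) fun ρ ⟨x, hx⟩ => hb (2 :: x) _ ?_ ?_ ?_).elim <;>
        simp [hx]
    refine ⟨List.replicate (z.length + 1) 2, by simp, by simp, ⟨_, List.replicate_succ⟩,
      replicate_two_lt _ _, dominant_wordPow_append hev (replicate_two_lt _ _)
      (fun j x w hG hx hw => (hb x w hG hx hw).append_left _) (fun x y h hx hy => ?_) k hk⟩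
    obtain ⟨y, d, rfl⟩ := List.eq_nil_or_concat' y |>.resolve_left hy
    rw [← List.append_assoc] at h
    obtain ⟨h, hd⟩ := List.append_inj' h rfl
    obtain ⟨-, -, h⟩ := List.replicate_eq_append_iff.1 h
    rw [← hd, h]
    exact replicate_two_lt _ _
  · classical
    push Not at hb
    have hex : ∃ n, ∃ x w, G = x ++ w ∧ x ≠ [] ∧ x.length = n ∧ w ≠ [] ∧
        ¬ WordLt w G := by
      obtain ⟨x, w, hG, hx, hw, h⟩ := hb
      exact ⟨x.length, x, w, hG, hx, rfl, hw, h⟩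
    obtain ⟨r, s, hr, hr0, hsl, hs0, hsG⟩ := Nat.find_spec hex
    have hmin : ∀ x w, G = x ++ w → x ≠ [] → s.length < w.length → WordLt w G := by
      intro x w hG hx hw
      by_contra hlt
      refine Nat.find_min hex (m := x.length) ?_ ⟨x, w, hG, hx, rfl, ?_, hlt⟩
      · have h := congrArg List.length hr
        rw [hG] at h
        simp at h
        omega
      · rintro rfl
        simp at hw
    clear hsl
    obtain ⟨⟨t, ht⟩, hodd⟩ := (hdich r s hr hr0 hs0).resolve_left hsG
    obtain ⟨e, rfl⟩ : s <+: r := by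
      rcases List.prefix_or_prefix_of_prefix ⟨t, ht⟩ ⟨s, hr.symm⟩ with h | ⟨c, rfl⟩
      · exact h
      exfalso
      have hc : c ≠ [] := by
        rintro rfl
        exact hsq r (by simpa using hr)
      have hct : c ++ t = r ++ c := by
        rw [hr, List.append_assoc] at ht
        exact List.append_cancel_left ht
      have hcG : c <+: G := ⟨t ++ t, by rw [← ht, ← List.append_assoc, hct]⟩
      rcases hdich (r ++ r) c (by simpa using hr) (by simp [hr0]) hc with h | ⟨-, h⟩
      · exact WordLt.not_of_prefix hcG h
      · rw [hr, List.count_append, List.count_append] at hev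
        grind
    have he0 : e ≠ [] := by
      rintro rfl
      exact hsq s (by simpa using hr)
    rw [List.append_assoc] at hr
    subst hr
    have hB : Bordered s e := by
      refine ⟨hdich, hmin, hodd, ?_, he0, fun h => h1 (by simp [h]), fun h => h1 (by simp [h])⟩
      simp only [List.count_append] at hev
      grind
    obtain ⟨e', x', rfl⟩ := List.eq_nil_or_concat' e |>.resolve_left he0
    refine ⟨s ++ (s ++ e'), by simp; omega, ?_, ?_, ?_, ?_⟩
    · intro h
      exact h1 (by simp at h ⊢; tauto)
    · obtain ⟨z, hz⟩ := h2
      rcases s with _ | ⟨c, s⟩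
      · simp at hs0
      · obtain ⟨rfl, -⟩ := List.cons_eq_cons.1 hz
        exact ⟨_, rfl⟩
    · simpa using hB.tail_lt e'
    · refine dominant_wordPow_append hev (by simpa using hB.tail_lt e') ?_ ?_ k hk
      · rintro (_ | j) x w hG hx hw
        · exact hB.suffix_append_tail_lt (e' := e') hG hx hw (Or.inl (by simp))
        · exact hB.suffix_append_tail_lt (e' := e') hG hx hw
            (Or.inr ⟨wordPow (s ++ (e' ++ [x'] ++ s)) j ++ (s ++ (s ++ e') ++ [1]),
              by simp [wordPow_succ]⟩)
      · intro x y hT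
        exact hB.tail_suffix_lt rfl (by simpa using hT)

/-- The letter ending the block of `a` in the substitution `blowUp`. -/
def endLetter (b a : Fin 3) : Fin 3 := if b = 0 then a else a.rev

/-- The substitution replacing each letter by a block consisting of `g` and one letter. -/
def blowUp (g : List (Fin 3)) (b : Fin 3) (x : List (Fin 3)) : List (Fin 3) :=
  x.flatMap fun a => g ++ [endLetter b a]

section BlowUp

variable {g x y : List (Fin 3)} {b : Fin 3}

theorem endLetter_eq_one {a : Fin 3} : endLetter b a = 1 ↔ a = 1 := by
  revert a b; decide

theorem endLetter_zero (hb : b ≠ 1) : endLetter b 0 = b := by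
  revert b; decide

@[simp] theorem blowUp_nil : blowUp g b [] = [] := rfl

@[simp] theorem blowUp_cons (a : Fin 3) (x : List (Fin 3)) :
    blowUp g b (a :: x) = g ++ endLetter b a :: blowUp g b x := by
  simp [blowUp]

@[simp] theorem blowUp_append (x y : List (Fin 3)) :
    blowUp g b (x ++ y) = blowUp g b x ++ blowUp g b y := by
  simp [blowUp]

theorem length_blowUp (x : List (Fin 3)) :
    (blowUp g b x).length = (g.length + 1) * x.length := by
  induction x with
  | nil => simp
  | cons a x ih => simp [ih]; ring

theorem blowUp_replicate_zero (hb : b ≠ 1) (k : ℕ) :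
    blowUp g b (List.replicate k 0) = wordPow (g ++ [b]) k := by
  induction k with
  | zero => rfl
  | succ k ih =>
    simp [List.replicate_succ, wordPow_succ, ih, endLetter_zero hb]

theorem blowUp_lt_blowUp (hb : b ≠ 1) (hev : Even ((g ++ [b]).count 2)) (h : WordLt x y)
    (hx : 1 ∉ x.dropLast) (hy : 1 ∉ y.dropLast) :
    WordLt (blowUp g b x) (blowUp g b y) := by
  have hdrop : ∀ {a : Fin 3} {z : List (Fin 3)}, 1 ∉ (a :: z).dropLast → 1 ∉ z.dropLast := by
    intro a z hz hmem
    rcases z with _ | ⟨c, z⟩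
    · simp at hmem
    · exact hz (List.mem_cons_of_mem _ hmem)
  induction h with
  | @head a c x y h =>
    rw [blowUp_cons, blowUp_cons]
    have hlt : b = 0 ∧ endLetter b a < endLetter b c ∨ b = 2 ∧ endLetter b c < endLetter b a := by
      clear hev hx hy hdrop
      revert a b c; decide
    rcases hlt with ⟨rfl, h⟩ | ⟨rfl, h⟩
    · rw [WordLt.append_even (by simpa using hev)]
      exact WordLt.head h
    · rw [WordLt.append_odd (by simpa [Nat.even_add_one] using hev)]
      exact WordLt.head h
  | @keep a x y ha h ih =>
    have ha1 : a ≠ 1 := by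
      rintro rfl
      rcases x with _ | ⟨c, x⟩
      · simp at h
      · simp at hx
    obtain rfl : a = 0 := (eq_zero_or_two_of_ne_one ha1).resolve_right ha
    rw [blowUp_cons, blowUp_cons, endLetter_zero hb, List.append_cons g b (blowUp g b x),
      List.append_cons g b (blowUp g b y),
      WordLt.append_even hev]
    exact ih (hdrop hx) (hdrop hy)
  | @flip x y h ih =>
    have hodd : ¬ Even ((g ++ [endLetter b 2]).count 2) := by
      rcases eq_zero_or_two_of_ne_one hb with rfl | rfl <;>
      simp_all [endLetter, Nat.even_add_one]
    rw [blowUp_cons, blowUp_cons, List.append_cons g _ (blowUp g b x),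
      List.append_cons g _ (blowUp g b y), WordLt.append_odd hodd]
    exact ih (hdrop hy) (hdrop hx)

theorem WordLt.not_lt_replicate_zero (k : ℕ) (x : List (Fin 3)) :
    ¬ WordLt x (List.replicate k 0) := by
  induction k generalizing x with
  | zero => simp
  | succ k ih =>
    rcases x with _ | ⟨a, x⟩
    · simp
    · simp only [List.replicate_succ, cons_cons, Fin.not_lt_zero, false_or]
      rintro ⟨rfl, ⟨-, h⟩ | ⟨h, -⟩⟩
      · exact ih x h
      · exact absurd h (by decide)

theorem blowUp_prefix (h : x <+: y) : blowUp g b x <+: blowUp g b y := by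
  obtain ⟨z, rfl⟩ := h
  simp

theorem not_blowUp_lt_wordPow (hb : b ≠ 1) (hev : Even ((g ++ [b]).count 2))
    (hx : 1 ∉ x.dropLast) (k : ℕ) : ¬ WordLt (blowUp g b x) (wordPow (g ++ [b]) k) := by
  rw [← blowUp_replicate_zero hb]
  have h0 : (1 : Fin 3) ∉ (List.replicate k 0).dropLast := by simp
  rcases WordLt.trichotomy x (List.replicate k 0) with h | h | h | h
  · exact WordLt.not_of_prefix (blowUp_prefix h)
  · exact WordLt.not_of_prefix' (blowUp_prefix h)
  · exact absurd h (WordLt.not_lt_replicate_zero k x)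
  · exact (blowUp_lt_blowUp hb hev h h0 hx).asymm

theorem Dominant.of_blowUp (hb : b ≠ 1) (hev : Even ((g ++ [b]).count 2))
    (hx : 1 ∉ x.dropLast) (h : Dominant (blowUp g b x)) : Dominant x := by
  rintro u v rfl hu hv
  have hlt := h (blowUp g b u) (blowUp g b v) (by simp)
    (by rintro h; simpa [length_blowUp, hu] using congrArg List.length h)
    (by rintro h; simpa [length_blowUp, hv] using congrArg List.length h)
  have hv' : 1 ∉ v.dropLast := by
    intro hmem
    rw [List.dropLast_append_of_ne_nil hv] at hx
    exact hx (by simp [hmem])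
  rcases WordLt.trichotomy v (u ++ v) with h' | h' | h' | h'
  · exact absurd hlt (WordLt.not_of_prefix (blowUp_prefix h'))
  · exact absurd hlt (WordLt.not_of_prefix' (blowUp_prefix h'))
  · exact h'
  · exact absurd hlt (blowUp_lt_blowUp hb hev h' hx hv').asymm

/-- A dominant word starting with the block of `2` and smaller than a blow-up is a blow-up. -/
theorem exists_eq_blowUp (hb : b ≠ 1) (hev : Even ((g ++ [b]).count 2)) {Γ : List (Fin 3)}
    (hΓ : Dominant Γ) (h1 : 1 ∉ Γ.dropLast) (hd : g.length + 1 ∣ Γ.length)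
    (hpre : g ++ [endLetter b 2] <+: Γ) (hx : 1 ∉ x.dropLast)
    (hlt : WordLt Γ (blowUp g b (2 :: x))) : ∃ y, Γ = blowUp g b (2 :: y) := by
  obtain ⟨ρ₁, rfl⟩ := hpre
  have hodd : ¬ Even ((g ++ [endLetter b 2]).count 2) := by
    rcases eq_zero_or_two_of_ne_one hb with rfl | rfl <;>
    simp_all [endLetter, Nat.even_add_one]
  rw [blowUp_cons, List.append_cons g _ (blowUp g b x), WordLt.append_odd hodd] at hlt
  have hlow : ∀ k, ¬ WordLt ρ₁ (wordPow (g ++ [b]) k) := fun k h =>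
    not_blowUp_lt_wordPow hb hev hx k (hlt.trans h)
  have aux : ∀ n, ∀ u ρ, ρ.length ≤ n → g ++ [endLetter b 2] ++ ρ₁ = u ++ ρ → u ≠ [] →
      g.length + 1 ∣ ρ.length → (∀ k, ¬ WordLt ρ (wordPow (g ++ [b]) k)) →
      ∃ y, ρ = blowUp g b y := by
    intro n
    induction n with
    | zero =>
      intro u ρ hl _ _ _ _
      obtain rfl := List.length_eq_zero_iff.1 (Nat.le_zero.1 hl)
      exact ⟨[], rfl⟩
    | succ n ih =>
      intro u ρ hl hu hu0 hdvd hρ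
      by_cases hρ0 : ρ = []
      · exact ⟨[], hρ0⟩
      have hlen := Nat.le_of_dvd (List.length_pos_iff.2 hρ0) hdvd
      have hdom := hΓ u ρ hu hu0 hρ0
      rcases WordLt.trichotomy g ρ with ⟨r, rfl⟩ | h | h | h
      · rcases r with _ | ⟨c, r⟩
        · simp at hlen
        have hdvd' : g.length + 1 ∣ r.length := by
          refine (Nat.dvd_add_right (dvd_refl (g.length + 1))).1 ?_
          convert hdvd using 1
          simp; ring
        have hl' : r.length ≤ n := by
          simp at hl; omega
        have hu' : g ++ [endLetter b 2] ++ ρ₁ = (u ++ (g ++ [c])) ++ r := by rw [hu]; simp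
        by_cases hc1 : c = 1
        · subst hc1
          have : r = [] := by
            by_contra hr
            rw [hu', List.dropLast_append_of_ne_nil hr] at h1
            simp at h1
          exact ⟨[1], by simp [this, endLetter_eq_one.2]⟩
        by_cases hcb : c = b
        · subst hcb
          obtain ⟨y, rfl⟩ := ih _ r hl' hu' (by simp) hdvd' fun k h => hρ (k + 1) <| by
            rwa [wordPow_succ, List.append_cons, WordLt.append_even hev]
          refine ⟨0 :: y, ?_⟩
          rw [blowUp_cons, endLetter_zero hb]
        · obtain rfl : c = endLetter b 2 := by
            rcases eq_zero_or_two_of_ne_one hb with rfl | rfl <;>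
            rcases eq_zero_or_two_of_ne_one hc1 with rfl | rfl <;>
            simp_all [endLetter]
          rw [List.append_cons, WordLt.append_odd hodd] at hdom
          obtain ⟨y, rfl⟩ := ih _ r hl' hu' (by simp) hdvd' fun k h => hlow k (hdom.trans h)
          exact ⟨2 :: y, by simp⟩
      · have := h.length_le
        omega
      · rw [List.append_assoc] at hdom
        exact absurd (h.append_left _) hdom.asymm
      · refine absurd ?_ (hρ 1)
        rw [wordPow_succ, List.append_assoc]
        exact h.append_right _
  have hdvd : g.length + 1 ∣ ρ₁.length := by
    refine (Nat.dvd_add_right (dvd_refl (g.length + 1))).1 ?_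
    convert hd using 1
    simp; ring
  obtain ⟨y, rfl⟩ := aux _ _ ρ₁ le_rfl rfl (by simp) hdvd hlow
  exact ⟨y, by simp⟩

end BlowUp

/-- The encoding of an α-sequence as a word: each entry `a` becomes `2, 0, …, 0` of length `a`. -/
def encode (α : List ℕ) : List (Fin 3) := α.flatMap fun a => 2 :: List.replicate (a - 1) 0

section Encode

variable {α β : List ℕ}

@[simp] theorem encode_nil : encode [] = [] := rfl

@[simp] theorem encode_cons (a : ℕ) (α : List ℕ) :
    encode (a :: α) = 2 :: (List.replicate (a - 1) 0 ++ encode α) := by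
  simp [encode]

@[simp] theorem encode_append (α β : List ℕ) : encode (α ++ β) = encode α ++ encode β := by
  simp [encode]

theorem length_encode (h : ∀ x ∈ α, 0 < x) : (encode α).length = α.sum := by
  induction α with
  | nil => rfl
  | cons a α ih =>
    simp only [List.mem_cons, forall_eq_or_imp] at h
    simp [ih h.2]
    omega

@[simp] theorem count_encode (α : List ℕ) : (encode α).count 2 = α.length := by
  induction α with
  | nil => rfl
  | cons a α ih => simp [ih, List.count_replicate]

theorem one_notMem_encode (α : List ℕ) : 1 ∉ encode α := by
  induction α with
  | nil => simp
  | cons a α ih => simp [ih]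

theorem exists_eq_replicate_append_encode {w : List (Fin 3)} (h : 1 ∉ w) :
    ∃ k α, (∀ x ∈ α, 0 < x) ∧ w = List.replicate k 0 ++ encode α := by
  induction w with
  | nil => exact ⟨0, [], by simp, rfl⟩
  | cons c w ih =>
    obtain ⟨k, α, hα, rfl⟩ := ih fun hw => h (List.mem_cons_of_mem _ hw)
    have hc : c ≠ 1 := by
      rintro rfl
      simp at h
    rcases eq_zero_or_two_of_ne_one hc with rfl | rfl
    · exact ⟨k + 1, α, hα, by simp [List.replicate_succ]⟩
    · exact ⟨0, (k + 1) :: α, by simpa using hα, by simp⟩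

theorem exists_eq_encode {z : List (Fin 3)} (h : 1 ∉ 2 :: z) :
    ∃ α, IsAlphaSeq α ∧ 2 :: z = encode α := by
  obtain ⟨_ | k, α, hα, hz⟩ := exists_eq_replicate_append_encode h
  · refine ⟨α, ⟨?_, hα⟩, hz⟩
    rintro rfl
    simp at hz
  · simp [List.replicate_succ] at hz

theorem lexLt_cons_cons {a b : ℕ} :
    lexLt (a :: α) (b :: β) ↔ a < b ∨ a = b ∧ lexLt β α := by
  have hs : ∀ (c : ℕ) (γ : List ℕ) (i : ℕ), Al (c :: γ) (i + 1) = - Al γ i := by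
    intro c γ i
    simp [Al, pow_succ]
  have h0 : ∀ (c : ℕ) (γ : List ℕ), Al (c :: γ) 0 = c := by simp [Al]
  constructor
  · rintro ⟨_ | i, hi, hlt⟩
    · rw [h0, h0] at hlt
      exact Or.inl (by exact_mod_cast hlt)
    · refine Or.inr ⟨?_, i, fun j hj => ?_, ?_⟩
      · have := hi 0 (by omega)
        rw [h0, h0] at this
        exact_mod_cast this
      · have := hi (j + 1) (by omega)
        rw [hs, hs] at this
        omega
      · rw [hs, hs] at hlt
        omega
  · rintro (h | ⟨rfl, i, hi, hlt⟩)
    · exact ⟨0, by simp, by rw [h0, h0]; exact_mod_cast h⟩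
    · refine ⟨i + 1, ?_, by rw [hs, hs]; omega⟩
      rintro (_ | j) hj
      · rw [h0, h0]
      · rw [hs, hs, hi j (by omega)]

theorem lexLt_nil_cons {b : ℕ} (hb : 0 < b) : lexLt [] (b :: β) :=
  ⟨0, by simp, by simpa [Al] using hb⟩

theorem not_lexLt_nil (h : ∀ x ∈ α, 0 < x) : ¬ lexLt α [] := by
  rintro ⟨i, hi, hlt⟩
  rcases α with _ | ⟨a, α⟩
  · simp [Al] at hlt
  · rcases i with _ | i
    · simp [Al] at hlt
      omega
    · have h0 := hi 0 (by omega)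
      have ha := h a (by simp)
      simp [Al] at h0
      omega

theorem WordLt.replicate_append {c d : Fin 3} {x y : List (Fin 3)} (hc : c ≠ 0) (hd : d ≠ 0)
    (p q : ℕ) : WordLt (List.replicate p 0 ++ c :: x) (List.replicate q 0 ++ d :: y) ↔
      q < p ∨ p = q ∧ WordLt (c :: x) (d :: y) := by
  induction p generalizing q with
  | zero =>
    rcases q with _ | q
    · simp
    · simp [List.replicate_succ, cons_cons, hc]
  | succ p ih =>
    rcases q with _ | q
    · simp [List.replicate_succ, cons_cons, Fin.pos_iff_ne_zero, hd]
    · simp [List.replicate_succ, cons_cons, ih]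

theorem encode_append_one_eq_cons (α : List ℕ) :
    ∃ c x, c ≠ 0 ∧ encode α ++ [1] = c :: x := by
  rcases α with _ | ⟨a, α⟩
  · exact ⟨1, [], by decide, rfl⟩
  · exact ⟨2, _, by decide, by rw [encode_cons, List.cons_append]⟩

theorem lexLt_iff_wordLt (hα : ∀ x ∈ α, 0 < x) (hβ : ∀ x ∈ β, 0 < x) :
    lexLt α β ↔ WordLt (encode α ++ [1]) (encode β ++ [1]) := by
  have step : ∀ {a b : ℕ} {α β : List ℕ}, 0 < a → 0 < b →
      (lexLt β α ↔ WordLt (encode β ++ [1]) (encode α ++ [1])) →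
      (lexLt (a :: α) (b :: β) ↔
        WordLt (encode (a :: α) ++ [1]) (encode (b :: β) ++ [1])) := by
    intro a b α β ha hb h
    obtain ⟨c, x, hc, hx⟩ := encode_append_one_eq_cons α
    obtain ⟨d, y, hd, hy⟩ := encode_append_one_eq_cons β
    rw [lexLt_cons_cons, encode_cons, encode_cons, List.cons_append, List.cons_append,
      WordLt.two_cons_iff, List.append_assoc, List.append_assoc, h, hx, hy,
      WordLt.replicate_append hd hc]
    have h1 : a = b ↔ b - 1 = a - 1 := by omega
    have h2 : a < b ↔ a - 1 < b - 1 := by omega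
    rw [h1, h2]
  suffices h : (lexLt α β ↔ WordLt (encode α ++ [1]) (encode β ++ [1])) ∧
      (lexLt β α ↔ WordLt (encode β ++ [1]) (encode α ++ [1])) from h.1
  induction α generalizing β with
  | nil =>
    rcases β with _ | ⟨b, β⟩
    · simp [not_lexLt_nil, WordLt.irrefl]
    · simp [WordLt.cons_cons, lexLt_nil_cons (hβ b (by simp)), not_lexLt_nil hβ]
  | cons a α ih =>
    rcases β with _ | ⟨b, β⟩
    · simp [WordLt.cons_cons, lexLt_nil_cons (hα a (by simp)), not_lexLt_nil hα]
    · simp only [List.mem_cons, forall_eq_or_imp] at hα hβ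
      have := ih hα.2 hβ.2
      exact ⟨step hα.1 hβ.1 this.2, step hβ.1 hα.1 this.1⟩

theorem lexLt_total (hα : ∀ x ∈ α, 0 < x) (hβ : ∀ x ∈ β, 0 < x) :
    α = β ∨ lexLt α β ∨ lexLt β α := by
  induction α generalizing β with
  | nil =>
    rcases β with _ | ⟨b, β⟩
    · exact Or.inl rfl
    · exact Or.inr (Or.inl (lexLt_nil_cons (hβ b (by simp))))
  | cons a α ih =>
    rcases β with _ | ⟨b, β⟩
    · exact Or.inr (Or.inr (lexLt_nil_cons (hα a (by simp))))
    · simp only [List.mem_cons, forall_eq_or_imp] at hα hβ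
      simp only [lexLt_cons_cons, List.cons.injEq]
      rcases lt_trichotomy a b with h | rfl | h
      · simp [h]
      · have := ih hα.2 hβ.2
        simp only [true_and, lt_irrefl, false_or]
        tauto
      · simp [h]

theorem encode_injective (hα : ∀ x ∈ α, 0 < x) (hβ : ∀ x ∈ β, 0 < x)
    (h : encode α = encode β) : α = β := by
  rcases lexLt_total hα hβ with h' | h' | h'
  · exact h'
  · rw [lexLt_iff_wordLt hα hβ, h] at h'
    exact absurd h' (WordLt.irrefl _)
  · rw [lexLt_iff_wordLt hβ hα, h] at h'
    exact absurd h' (WordLt.irrefl _)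

theorem suffix_encode {x y : List (Fin 3)} (h : encode α ++ [1] = x ++ y) (hy : y ≠ []) :
    (∃ i ≤ α.length, y = encode (α.drop i) ++ [1]) ∨ ∃ z, y = 0 :: z := by
  induction α generalizing x with
  | nil =>
    rcases x with _ | ⟨c, x⟩
    · exact Or.inl ⟨0, le_rfl, by simpa using h.symm⟩
    · simp at h
      exact absurd h.2.2 hy
  | cons a α ih =>
    rcases x with _ | ⟨c, x⟩
    · exact Or.inl ⟨0, by simp, by simpa using h.symm⟩
    · rw [encode_cons, List.cons_append, List.cons_append, List.append_assoc] at h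
      rcases List.append_eq_append_iff.1 (List.cons_eq_cons.1 h).2 with ⟨z, -, hz⟩ | ⟨w, hw, rfl⟩
      · rcases ih hz with ⟨i, hi, rfl⟩ | h'
        · exact Or.inl ⟨i + 1, by simpa using hi, by simp⟩
        · exact Or.inr h'
      · obtain ⟨-, -, hw⟩ := List.replicate_eq_append_iff.1 hw
        rcases hl : w.length with _ | l
        · rw [List.length_eq_zero_iff.1 hl]
          exact Or.inl ⟨1, by simp, by simp⟩
        · rw [hw, hl]
          exact Or.inr ⟨_, by rw [List.replicate_succ, List.cons_append]⟩

theorem isLexical_iff_dominant (hα : IsAlphaSeq α) :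
    IsLexical α ↔ Dominant (encode α ++ [1]) := by
  have hdrop : ∀ i, ∀ x ∈ α.drop i, 0 < x := fun i x hx => hα.2 x (List.mem_of_mem_drop hx)
  obtain ⟨a, α', rfl⟩ := List.exists_cons_of_ne_nil hα.1
  constructor
  · intro h x y hxy hx hy
    rcases suffix_encode hxy hy with ⟨i, hi, rfl⟩ | ⟨z, rfl⟩
    · rcases hi.lt_or_eq with hi | rfl
      · rcases i with _ | i
        · rw [List.drop_zero] at hxy
          exact absurd (List.self_eq_append_left.1 hxy) hx
        · rw [← lexLt_iff_wordLt (hdrop _) hα.2]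
          exact h.2 (i + 2) (by omega) (by omega)
      · simp [WordLt.cons_cons]
    · simp [WordLt.cons_cons]
  · refine fun h => ⟨hα, fun i h2 hi => ?_⟩
    rw [lexLt_iff_wordLt (hdrop _) hα.2]
    refine h (encode ((a :: α').take (i - 1))) _ ?_ ?_ (by simp)
    · rw [← List.append_assoc, ← encode_append, List.take_append_drop]
    · obtain ⟨i, rfl⟩ := Nat.exists_eq_add_of_le' h2
      simp

theorem encode_nrep (α : List ℕ) (q : ℕ) : encode (nrep α q) = wordPow (encode α) q := by
  induction q with
  | zero => rfl
  | succ q ih =>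
    rw [nrep] at ih
    rw [nrep, List.replicate_succ, List.flatten_cons, encode_append, ih, wordPow_succ]

theorem bumpLast_append_singleton (α : List ℕ) (a : ℕ) :
    bumpLast (α ++ [a]) = α ++ [a + 1] := by
  simp [bumpLast]

theorem encode_bumpLast (hα : IsAlphaSeq α) : encode (bumpLast α) = encode α ++ [0] := by
  obtain ⟨α, a, rfl⟩ := List.eq_nil_or_concat' α |>.resolve_left hα.1
  obtain ⟨a, rfl⟩ := Nat.exists_eq_add_of_lt (hα.2 a (by simp))
  simp [bumpLast_append_singleton, List.replicate_succ']

/-- The letter appended to the encoding by `seqE`. -/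
def evenLetter (α : List ℕ) : Fin 3 := if Even α.length then 0 else 2

theorem evenLetter_ne_one (α : List ℕ) : evenLetter α ≠ 1 := by
  unfold evenLetter; split_ifs <;> decide

theorem encode_seqE (hα : IsAlphaSeq α) : encode (seqE α) = encode α ++ [evenLetter α] := by
  unfold seqE evenLetter
  split_ifs
  · exact encode_bumpLast hα
  · simp

theorem encode_seqO (hα : IsAlphaSeq α) :
    encode (seqO α) = encode α ++ [endLetter (evenLetter α) 2] := by
  unfold seqO evenLetter
  split_ifs
  · simp [endLetter]
  · exact encode_bumpLast hα

theorem even_count_evenLetter (α : List ℕ) :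
    Even ((encode α ++ [evenLetter α]).count 2) := by
  unfold evenLetter
  split_ifs with h <;> simp_all

theorem pos_bumpLast (hα : ∀ x ∈ α, 0 < x) : ∀ x ∈ bumpLast α, 0 < x := by
  intro x hx
  rcases List.mem_append.1 hx with hx | hx
  · exact hα x (List.mem_of_mem_dropLast hx)
  · simp at hx
    omega

theorem pos_seqE (hα : ∀ x ∈ α, 0 < x) : ∀ x ∈ seqE α, 0 < x := by
  unfold seqE
  split_ifs
  · exact pos_bumpLast hα
  · simpa [or_imp, forall_and] using hα

theorem pos_seqO (hα : ∀ x ∈ α, 0 < x) : ∀ x ∈ seqO α, 0 < x := by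
  unfold seqO
  split_ifs
  · simpa [or_imp, forall_and] using hα
  · exact pos_bumpLast hα

theorem pos_nrep (hα : ∀ x ∈ α, 0 < x) (q : ℕ) : ∀ x ∈ nrep α q, 0 < x := by
  intro x hx
  obtain ⟨l, hl, hx⟩ := List.mem_flatten.1 hx
  rw [List.eq_of_mem_replicate hl] at hx
  exact hα x hx

theorem encode_starProd (hα : IsAlphaSeq α) (β : List ℕ) :
    encode (starProd α β) ++ [1] = blowUp (encode α) (evenLetter α) (encode β ++ [1]) := by
  have hstar : ∀ γ : List ℕ, encode (γ.map fun b => seqO α ++ nrep (seqE α) (b - 1)).flatten =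
      blowUp (encode α) (evenLetter α) (encode γ) := by
    intro γ
    induction γ with
    | nil => rfl
    | cons c γ ih =>
      simp [ih, encode_nrep, encode_seqE hα, encode_seqO hα,
        blowUp_replicate_zero (evenLetter_ne_one α)]
  simp [starProd, hstar, endLetter_eq_one.2]

end Encode

section Adjacent

theorem Set.Finite.exists_not_wordLt {S : Set (List (Fin 3))} (hf : S.Finite)
    (hS : S.Nonempty) : ∃ x ∈ S, ∀ y ∈ S, ¬ WordLt x y := by
  induction S, hf using Set.Finite.induction_on with
  | empty => simp at hS
  | @insert a S _ _ ih =>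
    rcases S.eq_empty_or_nonempty with rfl | hS
    · exact ⟨a, by simp, by simpa using WordLt.irrefl a⟩
    · obtain ⟨x, hx, hmax⟩ := ih hS
      by_cases hxa : WordLt x a
      · refine ⟨a, by simp, ?_⟩
        rintro y (rfl | hy) h
        · exact WordLt.irrefl _ h
        · exact hmax y hy (hxa.trans h)
      · refine ⟨x, by simp [hx], ?_⟩
        rintro y (rfl | hy)
        · exact hxa
        · exact hmax y hy

variable {g : List (Fin 3)} {b : Fin 3}

theorem append_lt_append_endLetter (hb : b ≠ 1) (hev : Even ((g ++ [b]).count 2)) :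
    WordLt (g ++ [b]) (g ++ [endLetter b 2]) := by
  rcases eq_zero_or_two_of_ne_one hb with rfl | rfl
  · rw [WordLt.append_even (by simpa using hev)]
    simp [endLetter, WordLt.cons_cons]
  · rw [WordLt.append_odd (by simpa [Nat.even_add_one] using hev)]
    simp [endLetter, WordLt.cons_cons]

theorem one_notMem_wordPow {G : List (Fin 3)} (h : 1 ∉ G) (k : ℕ) : 1 ∉ wordPow G k := by
  induction k with
  | zero => simp
  | succ k ih => simp [wordPow_succ, h, ih]

theorem length_wordPow (G : List (Fin 3)) (k : ℕ) :
    (wordPow G k).length = k * G.length := by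
  simp [wordPow]

/-- No suffix of a dominant word starting with `G` exceeds a power of `G`. -/
theorem Dominant.not_wordPow_lt {G Γ₀ Y : List (Fin 3)} (h1 : 1 ∉ G)
    (hev : Even (G.count 2)) (hΓ : Dominant (Γ₀ ++ [1])) (hG : Γ₀ ++ [1] = G ++ Y) (k : ℕ) :
    ∀ x ρ, Γ₀ ++ [1] = x ++ ρ → ¬ WordLt (wordPow G k) ρ := by
  induction k with
  | zero => simp
  | succ k ih =>
    intro x ρ hρ hlt
    have hρ0 : ρ ≠ [] := by
      rintro rfl
      simp at hlt
    rw [wordPow_succ] at hlt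
    rcases WordLt.trichotomy G ρ with ⟨ρ', rfl⟩ | h | h | h
    · rw [WordLt.append_even hev] at hlt
      exact ih (x ++ G) ρ' (by simpa using hρ) hlt
    · obtain ⟨ρ, c, rfl⟩ := List.eq_nil_or_concat' ρ |>.resolve_left hρ0
      rw [← List.append_assoc] at hρ
      obtain ⟨-, hc⟩ := List.append_inj' hρ rfl
      obtain rfl : 1 = c := by simpa using hc
      exact h1 (h.subset (by simp))
    · have hlt' : WordLt (Γ₀ ++ [1]) ρ := hG ▸ h.append_left Y
      by_cases hx : x = []
      · subst hx
        exact WordLt.irrefl ρ (by simpa [hρ] using hlt')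
      · exact hlt'.asymm (hΓ x ρ hρ hx hρ0)
    · exact hlt.asymm (h.append_right _)

/-- Dominant words lying above `G ^ k ++ V ++ [1]`, where `G = g ++ [b]`. -/
theorem Dominant.cases_of_wordPow_lt (hg : 1 ∉ g) (hb : b ≠ 1)
    (hev : Even ((g ++ [b]).count 2)) {k : ℕ} (hk : k ≠ 0) {Γ₀ z : List (Fin 3)} (h1 : 1 ∉ Γ₀)
    (hΓ : Dominant (Γ₀ ++ [1])) (hl : Γ₀.length + 1 = (g.length + 1) * (k + 1))
    (hg0 : g ≠ [])
    (hlt : WordLt (wordPow (g ++ [b]) k ++ (2 :: z ++ [1])) (Γ₀ ++ [1])) :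
    (∃ z', Γ₀ ++ [1] = wordPow (g ++ [b]) k ++ (2 :: z' ++ [1])) ∨
      g ++ [endLetter b 2] <+: Γ₀ ++ [1] ∨ WordLt g (Γ₀ ++ [1]) := by
  have hG1 : 1 ∉ g ++ [b] := by simpa [hg] using hb.symm
  have hmem : ∀ x, 1 ∉ x → ¬ Γ₀ ++ [1] <+: x := fun x hx h => hx (h.subset (by simp))
  have hle : 2 * g.length ≤ g.length * (k + 1) := by
    rw [mul_comm]; exact Nat.mul_le_mul_left _ (by omega)
  have hl' : (g.length + 1) * (k + 1) = g.length * (k + 1) + (k + 1) := by ring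
  rcases WordLt.trichotomy (wordPow (g ++ [b]) k) (Γ₀ ++ [1]) with ⟨ρ, hρ⟩ | h | h | h
  · left
    rw [← hρ, WordLt.append_even (even_count_wordPow hev k)] at hlt
    have hρ0 : ρ ≠ [] := by
      rintro rfl
      simp at hlt
    obtain ⟨ρ, c, rfl⟩ := List.eq_nil_or_concat' ρ |>.resolve_left hρ0
    rw [← List.append_assoc] at hρ
    obtain ⟨rfl, hc⟩ := List.append_inj' hρ rfl
    obtain rfl : c = 1 := by simpa using hc
    rcases ρ with _ | ⟨c, ρ⟩
    · simp [WordLt.cons_cons] at hlt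
    · refine ⟨ρ, ?_⟩
      simp only [List.cons_append, WordLt.cons_cons] at hlt
      obtain rfl : c = 2 := by
        rcases hlt with hlt | ⟨rfl, -⟩
        · exact absurd hlt (not_lt.2 (Fin.le_last c))
        · rfl
      simp
  · exact absurd h (hmem _ (one_notMem_wordPow hG1 k))
  · right
    rcases WordLt.trichotomy g (Γ₀ ++ [1]) with ⟨r, hr⟩ | h' | h' | h'
    · left
      rcases r with _ | ⟨c, r⟩
      · exact absurd ⟨[], by simpa using hr.symm⟩ (hmem g hg)
      have hc1 : c ≠ 1 := by
        rintro rfl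
        have hr0 : r ≠ [] := by
          rintro rfl
          have := congrArg List.length hr
          simp at this
          have := List.length_pos_iff.2 hg0
          omega
        have := congrArg List.dropLast hr
        rw [List.append_cons, List.dropLast_append_of_ne_nil hr0, List.dropLast_concat] at this
        exact h1 (this ▸ by simp)
      by_cases hcb : c = b
      · subst hcb
        exact absurd h (hΓ.not_wordPow_lt hG1 hev (Y := r) (by simp [← hr]) k [] _ rfl)
      · obtain rfl : c = endLetter b 2 := by
          rcases eq_zero_or_two_of_ne_one hb with rfl | rfl <;>
          rcases eq_zero_or_two_of_ne_one hc1 with rfl | rfl <;>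
          simp_all [endLetter]
        exact ⟨r, by simp [← hr]⟩
    · exact absurd h' (hmem g hg)
    · exact Or.inr h'
    · obtain ⟨k, rfl⟩ := Nat.exists_eq_succ_of_ne_zero hk
      rw [Nat.succ_eq_add_one, wordPow_succ, List.append_assoc] at h
      exact absurd h (h'.append_right _).asymm
  · exact absurd hlt (h.append_right _).asymm

end Adjacent

section Main

variable {g α lam γ : List ℕ} {m d n : ℕ}

theorem mem_Lset_iff : γ ∈ Lset n ↔
    IsAlphaSeq γ ∧ Dominant (encode γ ++ [1]) ∧ γ.sum + 1 = n := by
  constructor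
  · rintro ⟨h, hn⟩
    exact ⟨h.1, (isLexical_iff_dominant h.1).1 h, by omega⟩
  · rintro ⟨h, hd, hn⟩
    exact ⟨(isLexical_iff_dominant h).2 hd, by omega⟩

theorem encode_eq_two_cons (h : IsAlphaSeq α) : ∃ z, encode α = 2 :: z := by
  obtain ⟨a, α, rfl⟩ := List.exists_cons_of_ne_nil h.1
  exact ⟨_, encode_cons a α⟩

theorem not_lexLt_starProd (hn : n = m * d) (hg : g ∈ Lset m) (hlam : LeastIn (Lset d) lam)
    (hα' : starProd g lam ∈ Lset n) (hγ : γ ∈ Lset n)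
    (hpre : encode g ++ [endLetter (evenLetter g) 2] <+: encode γ ++ [1]) :
    ¬ lexLt γ (starProd g lam) := by
  intro hlt
  rw [mem_Lset_iff] at hg hα' hγ
  have hL := mem_Lset_iff.1 hlam.1
  obtain ⟨x, hx⟩ := encode_eq_two_cons hL.1
  have hb := evenLetter_ne_one g
  have hev := even_count_evenLetter g
  rw [lexLt_iff_wordLt hγ.1.2 hα'.1.2, encode_starProd hg.1] at hlt
  have hdrop : ∀ α, 1 ∉ (encode α ++ [1]).dropLast := fun α => by
    simpa using one_notMem_encode α
  have hm : (encode g).length + 1 = m := by rw [length_encode hg.1.2, hg.2.2]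
  have hl : (encode γ ++ [1]).length = m * d := by simp [length_encode hγ.1.2, hγ.2.2, hn]
  have hlt' := hlt
  rw [hx, List.cons_append] at hlt'
  have hx1 : 1 ∉ (x ++ [1]).dropLast := by
    have := one_notMem_encode lam
    rw [hx] at this
    simp at this ⊢
    exact this
  obtain ⟨y, hy⟩ := exists_eq_blowUp hb hev hγ.2.1 (hdrop γ) (by rw [hm, hl]; simp) hpre hx1 hlt'
  obtain ⟨u, c, huc⟩ := List.eq_nil_or_concat' (2 :: y) |>.resolve_left (by simp)
  rw [huc] at hy
  have hy' := hy
  rw [blowUp_append, blowUp_cons, blowUp_nil, ← List.append_assoc] at hy'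
  obtain ⟨hu, hc⟩ := List.append_inj' hy' rfl
  obtain rfl : c = 1 := endLetter_eq_one.1 (by simpa using hc.symm)
  have hu1 : 1 ∉ u := by
    intro hmem
    refine one_notMem_encode γ ?_
    rw [hu]
    exact List.mem_append_left _ (List.mem_flatMap.2 ⟨1, hmem, by simp [endLetter_eq_one.2]⟩)
  rcases u with _ | ⟨c, u⟩
  · simp at huc
  obtain rfl : 2 = c := (List.cons_eq_cons.1 huc).1
  obtain ⟨μ, hμ, hμu⟩ := exists_eq_encode hu1
  rw [hμu] at hy
  have hμd : μ ∈ Lset d := by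
    refine mem_Lset_iff.2 ⟨hμ, Dominant.of_blowUp hb hev (hdrop μ) (hy ▸ hγ.2.1), ?_⟩
    rw [hy, length_blowUp, hm] at hl
    have := Nat.eq_of_mul_eq_mul_left (by omega) hl
    rwa [List.length_append, length_encode hμ.2] at this
  rw [hy] at hlt
  by_cases hμl : μ = lam
  · subst hμl
    exact WordLt.irrefl _ hlt
  · have := (lexLt_iff_wordLt hL.1.2 hμ.2).1 (hlam.2 μ hμd hμl)
    exact (blowUp_lt_blowUp hb hev this (hdrop _) (hdrop _)).asymm hlt

theorem encode_dichotomy (hg : g ∈ Lset m) {x w : List (Fin 3)}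
    (h : encode g ++ [evenLetter g] = x ++ w) (hx : x ≠ []) (hw : w ≠ []) :
    WordLt w (encode g ++ [evenLetter g]) ∨
      (w <+: encode g ++ [evenLetter g] ∧ ¬ Even (w.count 2)) :=
  (mem_Lset_iff.1 hg).2.1.suffix_dichotomy (one_notMem_encode g) (evenLetter_ne_one g) h hx hw

/-- The even modification of a fundamental lexical sequence of large degree is not a square. -/
theorem encode_ne_square (hg : g ∈ Lset m) (hm : 3 ≤ m) (hfund : IsFundamental g)
    (s : List (Fin 3)) : encode g ++ [evenLetter g] ≠ s ++ s := by
  intro heq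
  have hg' := (mem_Lset_iff.1 hg).1
  have hl := congrArg List.length heq
  simp only [List.length_append, length_encode hg'.2, List.length_singleton,
    (mem_Lset_iff.1 hg).2.2] at hl
  have hs0 : s ≠ [] := by
    rintro rfl
    simp at hl
    omega
  have hodd : ¬ Even (s.count 2) := by
    rcases encode_dichotomy hg heq hs0 hs0 with h | ⟨-, h⟩
    · rw [heq] at h
      exact absurd h (WordLt.not_of_prefix (List.prefix_append s s))
    · exact h
  obtain ⟨s, c, rfl⟩ := List.eq_nil_or_concat' s |>.resolve_left hs0
  rw [← List.append_assoc] at heq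
  obtain ⟨hgs, hc⟩ := List.append_inj' heq rfl
  obtain rfl : evenLetter g = c := by simpa using hc
  rcases s with _ | ⟨a, s⟩
  · simp at hl
    omega
  obtain ⟨z, hz⟩ := encode_eq_two_cons hg'
  obtain rfl : 2 = a := by
    rw [hz] at hgs
    exact (List.cons_eq_cons.1 hgs).1
  have hs1 : 1 ∉ 2 :: s := fun h =>
    one_notMem_encode g (by rw [hgs]; exact List.mem_append_right _ h)
  obtain ⟨β, hβ, hβs⟩ := exists_eq_encode hs1
  rw [hβs] at hgs hodd
  have hlast : evenLetter g = endLetter (evenLetter β) 2 := by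
    rw [List.count_append, count_encode] at hodd
    rcases eq_zero_or_two_of_ne_one (evenLetter_ne_one g) with h | h <;> rw [h] at hodd ⊢ <;>
    simp [Nat.even_add_one] at hodd <;>
    simp [evenLetter, endLetter, hodd]
  refine hfund β hβ 1 le_rfl (encode_injective hg'.2 ?_ ?_)
  · intro x hx
    simp only [harmonicSeq, List.mem_append] at hx
    exact hx.elim (pos_seqO hβ.2 x) (hβ.2 x)
  · rw [harmonicSeq, harmonicSeq, encode_append, encode_seqO hβ, ← hlast, hgs]

theorem two_zero_prefix_encode (hγ : γ ∈ Lset n) (hn : 3 ≤ n) : [2, 0] <+: encode γ := by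
  obtain ⟨hpos, hdom, hsum⟩ := mem_Lset_iff.1 hγ
  have hl := length_encode hpos.2
  have h1 := one_notMem_encode γ
  obtain ⟨z, hz⟩ := encode_eq_two_cons hpos
  rw [hz] at hdom hl h1 ⊢
  rcases z with _ | ⟨c, z⟩
  · rw [List.length_singleton] at hl
    omega
  have hc : c ≠ 1 := fun h => h1 (by simp [h])
  rcases eq_zero_or_two_of_ne_one hc with rfl | rfl
  · exact ⟨z, rfl⟩
  · refine (WordLt.not_two_two (z := z ++ [1]) fun ρ ⟨x, hx⟩ => ?_).elim
    exact hdom (2 :: x) _ (by simp [hx]) (by simp) (by simp)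

theorem leastIn_starProd_of_two (hn : n = 2 * d) (hd : 2 ≤ d) (hg : g ∈ Lset 2)
    (hlam : LeastIn (Lset d) lam) (hα' : starProd g lam ∈ Lset n) :
    LeastIn (Lset n) (starProd g lam) := by
  refine ⟨hα', fun γ hγ hne => ?_⟩
  obtain ⟨hpos, -, hsum⟩ := mem_Lset_iff.1 hg
  obtain ⟨a, l, rfl⟩ := List.exists_cons_of_ne_nil hpos.1
  have hl := length_encode hpos.2
  obtain rfl : l = [] := by
    rcases l with _ | ⟨b, l⟩
    · rfl
    · have h₁ := hpos.2 a (by simp)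
      have h₂ := hpos.2 b (by simp)
      simp only [List.sum_cons] at hsum
      omega
  obtain rfl : a = 1 := by simpa using hsum
  refine ((lexLt_total (mem_Lset_iff.1 hα').1.2 (mem_Lset_iff.1 hγ).1.2).resolve_left
    hne.symm).resolve_right (not_lexLt_starProd hn hg hlam hα' hγ ?_)
  exact (two_zero_prefix_encode hγ (by omega)).trans (List.prefix_append _ _)

end Main

/-- if `α' = g ⋆ λ ∈ L_n` (with `g ∈ L_m` fundamental, `λ` least in
`L_d`, `n = md`) is not least in `L_n`, then some `(g_e)^{d-1} ĝ` with `D(ĝ) = m - 1`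
is the adjacent predecessor of `α'` in `L_n`. -/
theorem stmt_14 (m d n : ℕ) (hm : 2 ≤ m) (hd : 2 ≤ d) (hn : n = m * d)
    (g : List ℕ) (hg : g ∈ Lset m) (hfund : IsFundamental g)
    (lam : List ℕ) (hlam : LeastIn (Lset d) lam)
    (α' : List ℕ) (hαdef : α' = starProd g lam) (hα' : α' ∈ Lset n)
    (hnotleast : ¬ LeastIn (Lset n) α') :
    ∃ ghat : List ℕ, IsAlphaSeq ghat ∧ ghat.sum = m - 1 ∧
      (nrep (seqE g) (d - 1) ++ ghat) ∈ Lset n ∧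
      AdjLtIn (Lset n) (nrep (seqE g) (d - 1) ++ ghat) α' := by
  subst hαdef
  have hg' := mem_Lset_iff.1 hg
  have hα := mem_Lset_iff.1 hα'
  have hL := mem_Lset_iff.1 hlam.1
  have hb := evenLetter_ne_one g
  have hev := even_count_evenLetter g
  have hglen : (encode g).length + 1 = m := by rw [length_encode hg'.1.2, hg'.2.2]
  have hstar : ∃ r, encode (starProd g lam) ++ [1] =
      encode g ++ ([endLetter (evenLetter g) 2] ++ r) := by
    obtain ⟨x, hx⟩ := encode_eq_two_cons hL.1
    rw [encode_starProd hg'.1, hx, List.cons_append, blowUp_cons]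
    exact ⟨_, rfl⟩
  obtain ⟨r, hr⟩ := hstar
  have hrenorm := fun γ (hγ : γ ∈ Lset n) => not_lexLt_starProd hn hg hlam hα' hγ
  have hgt : ∀ γ ∈ Lset n, lexLt γ (starProd g lam) →
      ¬ WordLt (encode g) (encode γ ++ [1]) := by
    intro γ hγ hlt h
    rw [lexLt_iff_wordLt (mem_Lset_iff.1 hγ).1.2 hα.1.2, hr] at hlt
    exact hlt.asymm (h.append_left _)
  obtain ⟨k, rfl⟩ : ∃ k, d = k + 1 := ⟨d - 1, by omega⟩
  have hk : k ≠ 0 := by omega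
  rw [Nat.add_sub_cancel]
  obtain rfl | hm := hm.eq_or_lt
  · exact absurd (leastIn_starProd_of_two hn hd hg hlam hα') hnotleast
  obtain ⟨v₀, hv₀l, hv₀1, ⟨z₀, rfl⟩, -, hv₀⟩ := exists_tail
    (G := encode g ++ [evenLetter g]) (by simpa [one_notMem_encode] using hb.symm) hev
    (fun x w => encode_dichotomy hg)
    (by obtain ⟨z, hz⟩ := encode_eq_two_cons hg'.1; exact ⟨_, by rw [hz, List.cons_append]⟩)
    (by simp; omega) (encode_ne_square hg hm hfund) k hk
  let S : Set (List (Fin 3)) := {N | Dominant N ∧ N.length = n ∧ ∃ z, 1 ∉ 2 :: z ∧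
    N = wordPow (encode g ++ [evenLetter g]) k ++ (2 :: z ++ [1])}
  have hS : S.Finite := (List.finite_length_eq (Fin 3) n).subset fun N hN => hN.2.1
  obtain ⟨N, ⟨hN, hNl, z, hz1, rfl⟩, hmax⟩ := hS.exists_not_wordLt
    ⟨_, hv₀, by
      simp only [List.length_append, length_wordPow, List.length_singleton] at hv₀l ⊢
      rw [hv₀l, hglen, hn]
      ring, z₀, hv₀1, rfl⟩
  obtain ⟨v, hv, hvz⟩ := exists_eq_encode hz1
  have hNv : encode (nrep (seqE g) k ++ v) ++ [1] =
      wordPow (encode g ++ [evenLetter g]) k ++ (2 :: z ++ [1]) := by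
    rw [encode_append, encode_nrep, encode_seqE hg'.1, hvz, List.append_assoc]
  have hpos : IsAlphaSeq (nrep (seqE g) k ++ v) := by
    refine ⟨by simp [hv.1], fun x hx => ?_⟩
    exact (List.mem_append.1 hx).elim (pos_nrep (pos_seqE hg'.1.2) k x) (hv.2 x)
  have hmem : nrep (seqE g) k ++ v ∈ Lset n := by
    refine mem_Lset_iff.2 ⟨hpos, hNv ▸ hN, ?_⟩
    rw [← length_encode hpos.2, ← hNl, ← hNv, List.length_append, List.length_singleton]
  refine ⟨v, hv, ?_, hmem, ?_, ?_⟩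
  · rw [hvz] at hNl
    simp only [List.length_append, length_wordPow, List.length_singleton, hglen,
      length_encode hv.2, hn] at hNl
    have : m * (k + 1) = k * m + m := by ring
    omega
  · rw [lexLt_iff_wordLt hpos.2 hα.1.2, hNv, hr]
    obtain ⟨k, rfl⟩ := Nat.exists_eq_succ_of_ne_zero hk
    rw [wordPow_succ, List.append_assoc (_ ++ _), ← List.append_assoc _ _ r]
    exact (append_lt_append_endLetter hb hev).append _ _
  · rintro γ hγ ⟨h₁, h₂⟩
    have hγ' := mem_Lset_iff.1 hγ
    rw [lexLt_iff_wordLt hpos.2 hγ'.1.2, hNv] at h₁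
    have hγl := length_encode hγ'.1.2
    rcases hγ'.2.1.cases_of_wordPow_lt (one_notMem_encode g) hb hev hk (one_notMem_encode γ)
      (by rw [hglen, hγl, hγ'.2.2, hn])
      (by obtain ⟨z, hz⟩ := encode_eq_two_cons hg'.1; simp [hz]) h₁ with ⟨z', hz'⟩ | h | h
    · refine hmax _ ⟨hγ'.2.1, ?_, z', ?_, hz'⟩ h₁
      · rw [List.length_append, hγl, List.length_singleton, hγ'.2.2]
      · rw [← List.append_assoc] at hz'
        have := (List.append_inj' hz' rfl).1
        exact fun h => one_notMem_encode γ (this ▸ List.mem_append_right _ h)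
    · exact hrenorm γ hγ h h₂
    · exact hgt γ hγ h₂ h
end
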